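/- arXiv:2408.13436 — 2 statements merged into one kernel-verified Lean document; each statement's English description precedes it below -/
import Mathlib

section
/- Let G be a finite group, N ⊴ G a π-group, θ ∈ Irr(N) G-invariant with G = N·C_G(N), and χ ∈ Irr(G/N) a π-defect zero character (i.e., χ(1)_π = |G/N|_π). Define ψ(g) = θ(g_π)χ(Ng_{π'}) if g_π ∈ N and ψ(g) = 0 otherwise. Then ψ is an irreducible character of G, and ψ has relative π-defect zero over θ, i.e., (ψ(1)/θ(1))_π = |G/N|_π. -/
open scoped BigOperators
noncomputable section

open Classical in
/-- The `π`-part of a natural number: the product of prime powers in its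
factorization whose primes lie in `π`. -/
def Nat.piPart (π : Set ℕ) (n : ℕ) : ℕ :=
  n.factorization.prod fun p k => if p ∈ π then p ^ k else 1

/-- `n` is a `π`-number if every prime dividing `n` lies in `π`. -/
def IsPiNumber (π : Set ℕ) (n : ℕ) : Prop :=
  ∀ p : ℕ, p.Prime → p ∣ n → p ∈ π

/-- The `π`-part of an element of a finite group: the unique power of `g`
whose order is a `π`-number and whose complementary part has `π'`-order. -/
def elemPiPart (π : Set ℕ) {G : Type} [Group G] (g : G) : G :=
  g ^ ((orderOf g / Nat.piPart π (orderOf g)) ^ Nat.totient (Nat.piPart π (orderOf g)))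

/-- `χ` is the character of some finite-dimensional complex representation of `G`. -/
def IsChar (G : Type) [Group G] (χ : G → ℂ) : Prop :=
  ∃ V : FDRep ℂ G, ∀ g : G, χ g = V.character g

/-- The usual inner product of complex class functions. -/
def charInner (G : Type) [Group G] (φ ψ : G → ℂ) : ℂ :=
  (Nat.card G : ℂ)⁻¹ * ∑ᶠ g : G, φ g * starRingEnd ℂ (ψ g)

/-- An irreducible character: a character of norm one. -/
def IsIrrChar (G : Type) [Group G] (χ : G → ℂ) : Prop :=
  IsChar G χ ∧ charInner G χ χ = 1

/-- A class function. -/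
def IsClassFun (G : Type) [Group G] (φ : G → ℂ) : Prop :=
  ∀ g h : G, φ (h * g * h⁻¹) = φ g

/-- A virtual (generalized) character: a difference of two characters. -/
def IsGenChar (G : Type) [Group G] (ψ : G → ℂ) : Prop :=
  ∃ α β : G → ℂ, IsChar G α ∧ IsChar G β ∧ ψ = α - β

/-- `θ`, a character of the normal subgroup `N` of `G`, is `G`-invariant. -/
def IsGInvariant {G : Type} [Group G] (N : Subgroup G) [hN : N.Normal]
    (θ : ↥N → ℂ) : Prop :=
  ∀ (g : G) (n : ↥N), θ ⟨g * (n : G) * g⁻¹, hN.conj_mem (n : G) n.2 g⟩ = θ n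

/-- π-defect zero irreducible characters of a group `Q`. -/
def dzSet (π : Set ℕ) (Q : Type) [Group Q] : Set (Q → ℂ) :=
  {χ | IsIrrChar Q χ ∧ ∃ d : ℕ, χ 1 = (d : ℂ) ∧
    Nat.piPart π d = Nat.piPart π (Nat.card Q)}

/-- Irreducible characters of `G` lying over `θ ∈ Irr N` of relative π-defect zero. -/
def rdzSet (π : Set ℕ) (G : Type) [Group G] (N : Subgroup G) (θ : ↥N → ℂ) :
    Set (G → ℂ) :=
  {χ | IsIrrChar G χ ∧ charInner ↥N (fun n : ↥N => χ (n : G)) θ ≠ 0 ∧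
    ∃ m : ℕ, χ 1 = θ 1 * (m : ℂ) ∧ Nat.piPart π m = Nat.piPart π N.index}

open Module.End in
/-- The traces of the powers of an endomorphism `f` with `f ^ (e + 1) = f` are the power sums of
its eigenvalues. -/
theorem exists_trace_pow_eq_sum {V : Type*} [AddCommGroup V] [Module ℂ V] [FiniteDimensional ℂ V]
    {f : Module.End ℂ V} {e : ℕ} (he : e ≠ 0) (hf : f ^ (e + 1) = f) :
    ∃ (s : Finset ℂ) (m : ℂ → ℕ), (∀ μ ∈ s, μ ^ (e + 1) = μ) ∧
      ∀ k, LinearMap.trace ℂ V (f ^ k) = ∑ μ ∈ s, (m μ : ℂ) * μ ^ k := by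
  have hsq : Squarefree (Polynomial.X ^ (e + 1) - Polynomial.X : Polynomial ℂ) := by
    have h : (Polynomial.X ^ (e + 1) - Polynomial.X : Polynomial ℂ)
        = Polynomial.X * (Polynomial.X ^ e - Polynomial.C 1) := by
      rw [Polynomial.C_1]; ring
    rw [h]
    have h1 : (Polynomial.X ^ e - Polynomial.C 1 : Polynomial ℂ).Separable :=
      Polynomial.separable_X_pow_sub_C 1 (by exact_mod_cast he) one_ne_zero
    refine (Polynomial.Separable.mul Polynomial.separable_X h1 ?_).squarefree
    obtain ⟨d, rfl⟩ := Nat.exists_eq_succ_of_ne_zero he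
    refine ⟨Polynomial.X ^ d, -1, ?_⟩
    rw [Polynomial.C_1, Nat.succ_eq_add_one]; ring
  have hss : f.IsSemisimple := by
    refine isSemisimple_of_squarefree_aeval_eq_zero hsq ?_
    simp [hf]
  have hint : DirectSum.IsInternal fun μ : ℂ => f.eigenspace μ :=
    DirectSum.isInternal_submodule_of_iSupIndep_of_iSup_eq_top f.eigenspaces_iSupIndep
      hss.iSup_eigenspace_eq_top
  have hfin : {μ : ℂ | f.eigenspace μ ≠ ⊥}.Finite :=
    WellFoundedGT.finite_ne_bot_of_iSupIndep f.eigenspaces_iSupIndep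
  have happ : ∀ (k : ℕ) (μ : ℂ) (v : V), v ∈ f.eigenspace μ → (f ^ k) v = μ ^ k • v := by
    intro k μ v hv
    induction k with
    | zero => simp
    | succ k ih =>
      rw [pow_succ', Module.End.mul_apply, ih, map_smul, mem_eigenspace_iff.mp hv, smul_smul,
        pow_succ]
  refine ⟨hfin.toFinset, fun μ => Module.finrank ℂ (f.eigenspace μ), ?_, ?_⟩
  · intro μ hμ
    obtain ⟨v, hv, hv0⟩ := Submodule.exists_mem_ne_zero_of_ne_bot (hfin.mem_toFinset.mp hμ)
    have h := happ (e + 1) μ v hv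
    rw [hf, mem_eigenspace_iff.mp hv] at h
    exact (smul_left_injective ℂ hv0 h).symm
  · intro k
    have hmaps : ∀ μ : ℂ, Set.MapsTo (f ^ k) (f.eigenspace μ) (f.eigenspace μ) := by
      intro μ v hv
      rw [happ k μ v hv]
      exact Submodule.smul_mem _ _ hv
    rw [LinearMap.trace_eq_sum_trace_restrict' hint hfin hmaps]
    refine Finset.sum_congr rfl fun μ _ => ?_
    have : (f ^ k).restrict (hmaps μ) = μ ^ k • (LinearMap.id : f.eigenspace μ →ₗ[ℂ] _) := by
      ext v
      exact happ k μ v v.2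
    rw [this, map_smul, LinearMap.trace_id, smul_eq_mul, mul_comm]

theorem Matrix.exists_trace_pow_eq_sum {n : Type*} [Fintype n] [DecidableEq n]
    {M : Matrix n n ℂ} {e : ℕ} (he : e ≠ 0) (hM : M ^ (e + 1) = M) :
    ∃ (s : Finset ℂ) (m : ℂ → ℕ), (∀ μ ∈ s, μ ^ (e + 1) = μ) ∧
      ∀ k, (M ^ k).trace = ∑ μ ∈ s, (m μ : ℂ) * μ ^ k := by
  obtain ⟨s, m, hs, h⟩ := _root_.exists_trace_pow_eq_sum (f := Matrix.toLin' M) he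
    (by rw [← Matrix.toLin'_pow, hM])
  refine ⟨s, m, hs, fun k => ?_⟩
  rw [← h, ← Matrix.toLin'_pow, Matrix.trace_toLin'_eq]

theorem isIntegral_of_pow_succ_eq {e : ℕ} (he : e ≠ 0) {μ : ℂ} (h : μ ^ (e + 1) = μ) :
    IsIntegral ℤ μ := by
  refine ⟨Polynomial.X ^ (e + 1) - Polynomial.X, Polynomial.monic_X_pow_sub ?_, by simp [h]⟩
  rw [Polynomial.degree_X]
  exact_mod_cast Nat.lt_add_of_pos_left (Nat.pos_of_ne_zero he)

theorem Matrix.isIntegral_trace_of_pow_succ_eq {n : Type*} [Fintype n] [DecidableEq n]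
    {M : Matrix n n ℂ} {e : ℕ} (he : e ≠ 0) (hM : M ^ (e + 1) = M) : IsIntegral ℤ M.trace := by
  obtain ⟨s, m, hs, h⟩ := Matrix.exists_trace_pow_eq_sum he hM
  rw [← pow_one M, h]
  refine IsIntegral.sum _ fun μ hμ => ?_
  rw [pow_one]
  exact (isIntegral_algebraMap (R := ℤ) (x := (m μ : ℤ))).mul
    (isIntegral_of_pow_succ_eq he (hs μ hμ))

open Polynomial in
theorem Matrix.exists_polynomial_trace_pow {n : Type*} [Fintype n] [DecidableEq n]
    {M : Matrix n n ℂ} {e : ℕ} (he : e ≠ 0) (hM : M ^ (e + 1) = M) {ζ : ℂ}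
    (hζ : IsPrimitiveRoot ζ e) :
    ∃ P : ℤ[X], ∀ k, k ≠ 0 → (M ^ k).trace = aeval (ζ ^ k) P := by
  obtain ⟨s, m, hs, h⟩ := Matrix.exists_trace_pow_eq_sum he hM
  have : NeZero e := ⟨he⟩
  have hP : ∀ μ ∈ s, ∃ P : ℤ[X], ∀ k, k ≠ 0 → μ ^ k = aeval (ζ ^ k) P := by
    intro μ hμ
    by_cases h0 : μ = 0
    · exact ⟨0, fun k hk => by simp [h0, hk]⟩
    · have h1 : μ ^ e = 1 := by
        have := hs μ hμ
        rw [pow_succ] at this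
        exact mul_right_cancel₀ h0 (by rw [this, one_mul])
      obtain ⟨i, -, rfl⟩ := hζ.eq_pow_of_pow_eq_one h1
      exact ⟨X ^ i, fun k _ => by simp [← pow_mul, mul_comm]⟩
  choose! P hP using hP
  refine ⟨∑ μ ∈ s, (m μ : ℤ[X]) * P μ, fun k hk => ?_⟩
  rw [h, map_sum]
  refine Finset.sum_congr rfl fun μ hμ => ?_
  rw [hP μ hμ k hk]
  simp

open Polynomial in
/-- An integral polynomial taking the same value at all primitive roots of unity of a given order
takes an integral value there. -/
theorem exists_int_eq_aeval_of_forall_coprime {F : ℤ[X]} {e : ℕ} (he : e ≠ 0) {ζ : ℂ}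
    (hζ : IsPrimitiveRoot ζ e) (h : ∀ k, k ≠ 0 → k.Coprime e → aeval (ζ ^ k) F = aeval ζ F) :
    ∃ z : ℤ, aeval ζ F = z := by
  have hmon : (cyclotomic e ℤ).Monic := cyclotomic.monic e ℤ
  set R : ℤ[X] := F %ₘ cyclotomic e ℤ with hR
  have hroot : ∀ k, k.Coprime e → aeval (ζ ^ k) (cyclotomic e ℤ) = 0 := by
    intro k hk
    rw [← eval_map_algebraMap, map_cyclotomic]
    have : NeZero (e : ℂ) := ⟨by exact_mod_cast he⟩
    exact isRoot_cyclotomic_iff.mpr (hζ.pow_of_coprime k hk)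
  have hRF : ∀ k, k.Coprime e → aeval (ζ ^ k) R = aeval (ζ ^ k) F := by
    intro k hk
    conv_rhs => rw [← modByMonic_add_div F (cyclotomic e ℤ)]
    simp [hroot k hk, hR]
  have hRconst : ∀ k, k.Coprime e → aeval (ζ ^ k) R = aeval ζ F := by
    intro k hk
    rw [hRF k hk]
    by_cases hk0 : k = 0
    · have he1 : e = 1 := by simpa [hk0] using hk
      subst he1
      have : ζ = 1 := by simpa using hζ
      simp [this]
    · exact h k hk0 hk
  have hzero : R.map (algebraMap ℤ ℂ) - C (aeval ζ F) = 0 := by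
    refine eq_zero_of_degree_lt_of_eval_finset_eq_zero (primitiveRoots e ℂ) ?_ ?_
    · rw [hζ.card_primitiveRoots]
      refine (degree_sub_le _ _).trans_lt (max_lt ?_ ?_)
      · refine (degree_map_le).trans_lt ?_
        have := degree_modByMonic_lt F hmon
        rwa [degree_cyclotomic] at this
      · exact degree_C_le.trans_lt (by exact_mod_cast Nat.totient_pos.mpr (Nat.pos_of_ne_zero he))
    · intro x hx
      rw [mem_primitiveRoots (Nat.pos_of_ne_zero he)] at hx
      have : NeZero e := ⟨he⟩
      obtain ⟨k, -, hk, rfl⟩ := (hζ.isPrimitiveRoot_iff).mp hx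
      rw [eval_sub, eval_C, eval_map_algebraMap, hRconst k hk, sub_self]
  refine ⟨R.coeff 0, ?_⟩
  have := congrArg (fun p => coeff p 0) hzero
  simp only [coeff_sub, coeff_map, coeff_C_zero, coeff_zero, sub_eq_zero] at this
  simpa using this.symm

/-- The `t`-th Kronecker power of a square matrix. -/
def Matrix.tensorPow {n : Type*} (t : ℕ) (B : Matrix n n ℂ) : Matrix (Fin t → n) (Fin t → n) ℂ :=
  Matrix.of fun f g => ∏ i, B (f i) (g i)

theorem Matrix.tensorPow_mul {n : Type*} [Fintype n] [DecidableEq n] (t : ℕ)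
    (B C : Matrix n n ℂ) :
    Matrix.tensorPow t (B * C) = Matrix.tensorPow t B * Matrix.tensorPow t C := by
  ext f g
  simp only [Matrix.tensorPow, Matrix.of_apply, Matrix.mul_apply, ← Finset.prod_mul_distrib]
  rw [Finset.prod_univ_sum, Fintype.piFinset_univ]

theorem Matrix.sum_path_eq {n : Type*} [Fintype n] [DecidableEq n] (B : Matrix n n ℂ) (t : ℕ)
    (u : n → n → ℂ) :
    ∑ f : Fin (t + 1) → n, (∏ i : Fin t, B (f i.castSucc) (f i.succ)) * u (f 0) (f (Fin.last t)) =
      ∑ x, ∑ y, (B ^ t) x y * u x y := by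
  induction t generalizing u with
  | zero =>
    rw [← (Equiv.funUnique (Fin 1) n).symm.sum_comp]
    simp [Matrix.one_apply, Equiv.funUnique]
  | succ t ih =>
    rw [← (Fin.consEquiv fun _ => n).sum_comp, Fintype.sum_prod_type]
    simp only [Fin.consEquiv_apply, Fin.prod_univ_succ, Fin.castSucc_zero, Fin.cons_zero,
      Fin.cons_succ, ← Fin.succ_castSucc, ← Fin.succ_last]
    refine Finset.sum_congr rfl fun x _ => ?_
    have := ih fun y z => B x y * u x z
    calc _ = ∑ f : Fin (t + 1) → n, (∏ i : Fin t, B (f i.castSucc) (f i.succ)) *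
          (B x (f 0) * u x (f (Fin.last t))) :=
          Finset.sum_congr rfl fun f _ => by ring
      _ = _ := by
        rw [this, Finset.sum_comm]
        refine Finset.sum_congr rfl fun z _ => ?_
        rw [pow_succ', Matrix.mul_apply, Finset.sum_mul]
        exact Finset.sum_congr rfl fun y _ => by ring

/-- The permutation of `Fin t → n` given by the cyclic rotation of the coordinates. -/
def rotatePerm (n : Type*) (t : ℕ) : Equiv.Perm (Fin t → n) :=
  (finRotate t).symm.arrowCongr (Equiv.refl n)

theorem rotatePerm_apply {n : Type*} {t : ℕ} (f : Fin t → n) (i : Fin t) :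
    rotatePerm n t f i = f (finRotate t i) := rfl

theorem rotatePerm_pow (n : Type*) (t : ℕ) : rotatePerm n t ^ t = 1 := by
  have key : ∀ (k : ℕ) (f : Fin t → n) (i : Fin t),
      (rotatePerm n t ^ k) f i = f ((finRotate t ^ k) i) := by
    intro k
    induction k with
    | zero => intro f i; rfl
    | succ k ih =>
      intro f i
      rw [pow_succ, Equiv.Perm.mul_apply, ih, rotatePerm_apply, pow_succ', Equiv.Perm.mul_apply]
  have hrot : finRotate t ^ t = 1 := by
    rcases t with _ | _ | t
    · rfl
    · decide
    · have := pow_orderOf_eq_one (finRotate (t + 2))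
      rwa [(isCycle_finRotate (n := t)).orderOf, support_finRotate, Finset.card_univ,
        Fintype.card_fin] at this
  ext f i
  rw [key, hrot]
  rfl

theorem Matrix.permMatrix_rotatePerm_mul_tensorPow {n : Type*} [Fintype n] [DecidableEq n] (t : ℕ)
    (B : Matrix n n ℂ) :
    (rotatePerm n t).permMatrix ℂ * Matrix.tensorPow t B =
      Matrix.tensorPow t B * (rotatePerm n t).permMatrix ℂ := by
  rw [Equiv.Perm.permMatrix, PEquiv.toMatrix_toPEquiv_mul, PEquiv.mul_toMatrix_toPEquiv]
  ext f g
  simp only [Matrix.submatrix_apply, Matrix.tensorPow, Matrix.of_apply, id]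
  refine Fintype.prod_equiv (finRotate t) _ _ fun i => ?_
  rw [rotatePerm_apply]
  congr 1
  change _ = g ((finRotate t).symm (finRotate t i))
  rw [Equiv.symm_apply_apply]

theorem Matrix.trace_permMatrix_rotatePerm_mul_tensorPow {n : Type*} [Fintype n] [DecidableEq n]
    {t : ℕ} (ht : t ≠ 0) (B : Matrix n n ℂ) :
    ((rotatePerm n t).permMatrix ℂ * Matrix.tensorPow t B).trace = (B ^ t).trace := by
  obtain ⟨t, rfl⟩ := Nat.exists_eq_succ_of_ne_zero ht
  have h : ((rotatePerm n (t + 1)).permMatrix ℂ * Matrix.tensorPow (t + 1) B).trace =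
      ∑ f : Fin (t + 1) → n, (∏ i : Fin t, B.transpose (f i.castSucc) (f i.succ)) *
        B.transpose (f (Fin.last t)) (f 0) := by
    rw [Equiv.Perm.permMatrix, PEquiv.toMatrix_toPEquiv_mul, Matrix.trace]
    refine Finset.sum_congr rfl fun f _ => ?_
    simp only [Matrix.diag_apply, Matrix.submatrix_apply, Matrix.tensorPow, Matrix.of_apply, id,
      rotatePerm_apply, Matrix.transpose_apply]
    rw [Fin.prod_univ_castSucc]
    simp
  rw [Nat.succ_eq_add_one, h, Matrix.sum_path_eq B.transpose t fun x y => B.transpose y x]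
  rw [← Matrix.trace_transpose (B ^ (t + 1)), Matrix.transpose_pow, pow_succ, Matrix.trace]
  simp [Matrix.mul_apply]

theorem Matrix.isIntegral_average_trace_mul {H : Type*} [Group H] [Fintype H] {N : Type*}
    [Fintype N] [DecidableEq N] (D : H →ₙ* Matrix N N ℂ) (S : Matrix N N ℂ) {t : ℕ} (ht : t ≠ 0)
    (hS : S ^ t = 1) (hSD : ∀ h, S * D h = D h * S) :
    IsIntegral ℤ ((Fintype.card H : ℂ)⁻¹ * ∑ h, (S * D h).trace) := by
  set P : Matrix N N ℂ := (Fintype.card H : ℂ)⁻¹ • ∑ h, D h with hP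
  have hc : (Fintype.card H : ℂ) ≠ 0 := by exact_mod_cast Fintype.card_ne_zero
  have hDP : ∀ h, D h * P = P := by
    intro h
    rw [hP, Matrix.mul_smul, Finset.mul_sum]
    simp_rw [← map_mul]
    rw [← Equiv.sum_comp (Equiv.mulLeft h) (fun x => D x)]
    simp
  have hPP : IsIdempotentElem P := by
    unfold IsIdempotentElem
    nth_rewrite 1 [hP]
    rw [Matrix.smul_mul, Finset.sum_mul, Finset.sum_congr rfl fun h _ => hDP h]
    rw [Finset.sum_const, Finset.card_univ, ← Nat.cast_smul_eq_nsmul ℂ, smul_smul,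
      inv_mul_cancel₀ hc, one_smul]
  have hSP : Commute S P := by
    change S * P = P * S
    rw [hP, Matrix.mul_smul, Matrix.smul_mul, Finset.mul_sum, Finset.sum_mul]
    simp_rw [hSD]
  have hpow : (S * P) ^ (t + 1) = S * P := by
    rw [hSP.mul_pow, pow_succ S, hS, one_mul, hPP.pow_succ_eq]
  have := Matrix.isIntegral_trace_of_pow_succ_eq ht hpow
  rw [hP, Matrix.mul_smul, Matrix.trace_smul, Finset.mul_sum, Matrix.trace_sum, smul_eq_mul] at this
  exact this

open Kronecker in
theorem isIntegral_average_trace_mul_trace_pow {H : Type*} [Group H] [Fintype H] {m n : Type*}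
    [Fintype m] [DecidableEq m] [Fintype n] [DecidableEq n] (A : H →ₙ* Matrix m m ℂ)
    (B : H →ₙ* Matrix n n ℂ) {t : ℕ} (ht : t ≠ 0) :
    IsIntegral ℤ ((Fintype.card H : ℂ)⁻¹ * ∑ h, (A h).trace * (B h ^ t).trace) := by
  let D : H →ₙ* Matrix (m × (Fin t → n)) (m × (Fin t → n)) ℂ :=
    { toFun := fun h => A h ⊗ₖ Matrix.tensorPow t (B h)
      map_mul' := fun x y => by
        rw [map_mul, map_mul, Matrix.tensorPow_mul, Matrix.mul_kronecker_mul] }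
  let S : Matrix (m × (Fin t → n)) (m × (Fin t → n)) ℂ :=
    (1 : Matrix m m ℂ) ⊗ₖ (rotatePerm n t).permMatrix ℂ
  have hSpow : ∀ k, S ^ k = (1 : Matrix m m ℂ) ⊗ₖ (rotatePerm n t ^ k).permMatrix ℂ := by
    intro k
    induction k with
    | zero => simp
    | succ k ih =>
      rw [pow_succ, ih, ← Matrix.mul_kronecker_mul, one_mul, ← Matrix.permMatrix_mul, pow_succ']
  have hS : S ^ t = 1 := by
    rw [hSpow, rotatePerm_pow]
    simp
  have hSD : ∀ h, S * D h = D h * S := by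
    intro h
    change (1 : Matrix m m ℂ) ⊗ₖ _ * (A h ⊗ₖ _) = (A h ⊗ₖ _) * ((1 : Matrix m m ℂ) ⊗ₖ _)
    rw [← Matrix.mul_kronecker_mul, ← Matrix.mul_kronecker_mul, one_mul, mul_one,
      Matrix.permMatrix_rotatePerm_mul_tensorPow]
  have key := Matrix.isIntegral_average_trace_mul D S ht hS hSD
  have hsum : ∑ h, (A h).trace * (B h ^ t).trace = ∑ h, (S * D h).trace := by
    refine Finset.sum_congr rfl fun h _ => ?_
    change _ = Matrix.trace ((1 : Matrix m m ℂ) ⊗ₖ (rotatePerm n t).permMatrix ℂ *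
      (A h ⊗ₖ Matrix.tensorPow t (B h)))
    rw [← Matrix.mul_kronecker_mul, one_mul, Matrix.trace_kronecker,
      Matrix.trace_permMatrix_rotatePerm_mul_tensorPow ht]
  rwa [hsum]

theorem MulHom.map_pow_of_ne_zero {H M : Type*} [Monoid H] [Monoid M] (f : H →ₙ* M) (h : H)
    {k : ℕ} (hk : k ≠ 0) : f (h ^ k) = f h ^ k := by
  obtain ⟨k, rfl⟩ := Nat.exists_eq_succ_of_ne_zero hk
  clear hk
  induction k with
  | zero => simp
  | succ k ih => rw [pow_succ, map_mul, ih, pow_succ _ (k + 1)]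

theorem MulHom.pow_card_succ_eq {H M : Type*} [Group H] [Fintype H] [Monoid M] (f : H →ₙ* M)
    (h : H) : f h ^ (Fintype.card H + 1) = f h := by
  rw [← f.map_pow_of_ne_zero h (Nat.succ_ne_zero _), pow_succ, pow_card_eq_one, one_mul]

open Polynomial in
/-- Integrality of the pairing of a character with an Adams operation applied to another one. -/
theorem exists_int_sum_trace_mul_trace_pow {H : Type*} [Group H] [Fintype H] {m n : Type*}
    [Fintype m] [DecidableEq m] [Fintype n] [DecidableEq n] (A : H →ₙ* Matrix m m ℂ)
    (B : H →ₙ* Matrix n n ℂ) {t : ℕ} (ht : t ≠ 0) :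
    ∃ z : ℤ, (Fintype.card H : ℂ)⁻¹ * ∑ h, (A h).trace * (B (h ^ t)).trace = z := by
  set e := Fintype.card H with he
  have he0 : e ≠ 0 := Fintype.card_ne_zero
  have hζ := Complex.isPrimitiveRoot_exp e he0
  set ζ := Complex.exp (2 * Real.pi * Complex.I / e)
  choose P hP using fun h => Matrix.exists_polynomial_trace_pow he0 (A.pow_card_succ_eq h) hζ
  choose Q hQ using fun h => Matrix.exists_polynomial_trace_pow he0 (B.pow_card_succ_eq h) hζ
  set F : ℤ[X] := ∑ h, P h * expand ℤ t (Q h) with hF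
  have hval : ∀ k, k ≠ 0 →
      aeval (ζ ^ k) F = ∑ h, (A (h ^ k)).trace * (B ((h ^ k) ^ t)).trace := by
    intro k hk
    rw [hF, map_sum]
    refine Finset.sum_congr rfl fun h _ => ?_
    rw [map_mul, expand_aeval, ← pow_mul, ← hP h k hk, ← hQ h _ (mul_ne_zero hk ht),
      A.map_pow_of_ne_zero h hk, ← pow_mul, B.map_pow_of_ne_zero h (mul_ne_zero hk ht)]
  have hval1 : aeval ζ F = ∑ h, (A h).trace * (B (h ^ t)).trace := by
    simpa using hval 1 one_ne_zero
  obtain ⟨z, hz⟩ := exists_int_eq_aeval_of_forall_coprime (F := F) he0 hζ (by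
    intro k hk hke
    rw [hval k hk, hval1]
    have hcop : (Nat.card H).Coprime k := by rw [Nat.card_eq_fintype_card]; exact hke.symm
    exact Equiv.sum_comp (powCoprime hcop) fun h => (A h).trace * (B (h ^ t)).trace)
  have hint := isIntegral_average_trace_mul_trace_pow A B ht
  have heq : ∑ h, (A h).trace * (B h ^ t).trace = z := by
    rw [← hz, hval1]
    exact Finset.sum_congr rfl fun h _ => by rw [B.map_pow_of_ne_zero h ht]
  have hrat : ((algebraMap ℚ ℂ) ((e : ℚ)⁻¹ * z)) = (e : ℂ)⁻¹ * z := by simp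
  rw [heq, ← he, ← hrat, isIntegral_algebraMap_iff (algebraMap ℚ ℂ).injective,
    IsIntegrallyClosed.isIntegral_iff] at hint
  obtain ⟨w, hw⟩ := hint
  refine ⟨w, ?_⟩
  rw [← hval1, hz, ← hrat, ← hw]
  simp

theorem LinearMap.trace_eq_add_trace_restrict_of_isCompl {V : Type*} [AddCommGroup V] [Module ℂ V]
    [FiniteDimensional ℂ V] {W W' : Submodule ℂ V} (h : IsCompl W W') (f : Module.End ℂ V)
    (hW : ∀ v ∈ W, f v ∈ W) (hW' : ∀ v ∈ W', f v ∈ W') :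
    LinearMap.trace ℂ V f =
      LinearMap.trace ℂ W (f.restrict hW) + LinearMap.trace ℂ W' (f.restrict hW') := by
  have hint : DirectSum.IsInternal fun b : Bool => cond b W W' :=
    (DirectSum.isInternal_submodule_iff_isCompl (fun b : Bool => cond b W W') (i := true)
      (j := false) (by simp) (by ext b; cases b <;> simp)).mpr h
  have hf : ∀ b : Bool,
      Set.MapsTo f (cond b W W' : Submodule ℂ V) (cond b W W' : Submodule ℂ V) := by
    rintro (_ | _)
    · exact hW'
    · exact hW
  rw [LinearMap.trace_eq_sum_trace_restrict hint hf, Fintype.sum_bool]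
  rfl

theorem Representation.character_inv {G V : Type*} [Group G] [Finite G] [AddCommGroup V]
    [Module ℂ V] [FiniteDimensional ℂ V] (ρ : Representation ℂ G V) (g : G) :
    ρ.character g⁻¹ = starRingEnd ℂ (ρ.character g) := by
  set e := Nat.card G with he
  have he0 : e ≠ 0 := Nat.card_ne_zero.mpr ⟨⟨1⟩, inferInstance⟩
  have hg : g ^ e = 1 := pow_card_eq_one'
  obtain ⟨s, m, hs, h⟩ := exists_trace_pow_eq_sum (f := ρ g) he0
    (by rw [← map_pow, pow_succ, hg, one_mul])
  have hinv : g⁻¹ = g ^ (e + (e - 1)) := by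
    rw [pow_add, hg, one_mul, inv_eq_iff_mul_eq_one, ← pow_succ', Nat.sub_add_cancel
      (Nat.pos_of_ne_zero he0), hg]
  have h1 := h 1
  rw [pow_one] at h1
  simp only [Representation.character]
  rw [h1, hinv, map_pow, h, map_sum]
  refine Finset.sum_congr rfl fun μ hμ => ?_
  rw [map_mul, map_natCast, pow_one]
  congr 1
  by_cases h0 : μ = 0
  · rw [h0, map_zero, zero_pow (by omega)]
  · have hμe : μ ^ e = 1 := by
      have := hs μ hμ
      rw [pow_succ] at this
      exact mul_right_cancel₀ h0 (by rw [this, one_mul])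
    rw [← Complex.inv_eq_conj (Complex.norm_eq_one_of_pow_eq_one hμe he0)]
    refine eq_inv_of_mul_eq_one_left ?_
    rw [← pow_succ, show e + (e - 1) + 1 = e + e by omega, pow_add, hμe, one_mul]

theorem charInner_eq_sum {G : Type} [Group G] [Fintype G] (φ ψ : G → ℂ) :
    charInner G φ ψ = (Nat.card G : ℂ)⁻¹ * ∑ g, φ g * starRingEnd ℂ (ψ g) := by
  rw [charInner, finsum_eq_sum_of_fintype]

theorem Representation.isChar_character {G V : Type} [Group G] [AddCommGroup V] [Module ℂ V]
    [FiniteDimensional ℂ V] (ρ : Representation ℂ G V) : IsChar G ρ.character :=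
  ⟨FDRep.of ρ, fun _ => rfl⟩

theorem Representation.isIrrChar_character {G V : Type} [Group G] [Finite G] [AddCommGroup V]
    [Module ℂ V] [FiniteDimensional ℂ V] (ρ : Representation ℂ G V) [ρ.IsIrreducible] :
    IsIrrChar G ρ.character := by
  have := Fintype.ofFinite G
  have : Invertible (Nat.card G : ℂ) := invertibleOfNonzero (by exact_mod_cast Nat.card_pos.ne')
  refine ⟨ρ.isChar_character, ?_⟩
  rw [charInner_eq_sum]
  simp_rw [← Representation.character_inv]
  rw [Representation.char_orthonormal, if_pos ⟨Representation.Equiv.refl ρ⟩]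

theorem exists_isIrrChar_map_ne_zero {G : Type} [Group G] [Finite G] (L : (G → ℂ) →+ ℂ) {V : Type}
    [AddCommGroup V] [Module ℂ V] [FiniteDimensional ℂ V] (ρ : Representation ℂ G V)
    (hL : L ρ.character ≠ 0) : ∃ ξ : G → ℂ, IsIrrChar G ξ ∧ L ξ ≠ 0 := by
  induction hd : Module.finrank ℂ V using Nat.strong_induction_on generalizing V with
  | _ d ih =>
    by_cases hirr : ρ.IsIrreducible
    · exact ⟨_, ρ.isIrrChar_character, hL⟩
    have hV : Nontrivial (Subrepresentation ρ) := by
      by_contra hV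
      rw [not_nontrivial_iff_subsingleton] at hV
      have hbt : (⊥ : Submodule ℂ V) = ⊤ :=
        congrArg Subrepresentation.toSubmodule (Subsingleton.elim (⊥ : Subrepresentation ρ) ⊤)
      have hsub : Subsingleton V :=
        (Submodule.subsingleton_iff ℂ).mp (subsingleton_of_bot_eq_top hbt)
      refine hL ?_
      rw [show ρ.character = 0 from ?_, map_zero]
      ext g
      rw [Representation.character, Subsingleton.elim (ρ g) 0]
      simp
    obtain ⟨W, hW0, hW1⟩ : ∃ W : Subrepresentation ρ, W ≠ ⊥ ∧ W ≠ ⊤ := by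
      by_contra! h
      exact hirr ⟨fun W => or_iff_not_imp_left.mpr (h W)⟩
    have : NeZero (Nat.card G : ℂ) := ⟨by exact_mod_cast Nat.card_pos.ne'⟩
    have hss : Representation.IsSemisimpleRepresentation ρ := inferInstance
    obtain ⟨W', hWW'⟩ := exists_isCompl W
    have hcompl : IsCompl W.toSubmodule W'.toSubmodule := by
      refine ⟨disjoint_iff.mpr ?_, codisjoint_iff.mpr ?_⟩
      · exact congrArg Subrepresentation.toSubmodule hWW'.inf_eq_bot
      · exact congrArg Subrepresentation.toSubmodule hWW'.sup_eq_top
    have hlt : ∀ U : Subrepresentation ρ, U ≠ ⊤ → Module.finrank ℂ U.toSubmodule < d := by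
      intro U hU
      rw [← hd]
      exact Submodule.finrank_lt fun h => hU (Subrepresentation.toSubmodule_injective h)
    have hW'1 : W' ≠ ⊤ := by
      rintro rfl
      exact hW0 (by simpa using hWW'.inf_eq_bot)
    have hadd : ρ.character = W.toRepresentation.character + W'.toRepresentation.character := by
      ext g
      exact LinearMap.trace_eq_add_trace_restrict_of_isCompl hcompl (ρ g)
        (W.apply_mem_toSubmodule g) (W'.apply_mem_toSubmodule g)
    rw [hadd, map_add] at hL
    by_cases h1 : L W.toRepresentation.character = 0
    · rw [h1, zero_add] at hL
      exact ih _ (hlt W' hW'1) W'.toRepresentation hL rfl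
    · exact ih _ (hlt W hW1) W.toRepresentation h1 rfl

theorem exists_isIrrChar_charInner_ne_zero {G : Type} [Group G] [Finite G] (ψ : G → ℂ)
    (hψ : ψ 1 ≠ 0) : ∃ ξ : G → ℂ, IsIrrChar G ξ ∧ charInner G ψ ξ ≠ 0 := by
  classical
  have := Fintype.ofFinite G
  have hc : (Nat.card G : ℂ) ≠ 0 := by exact_mod_cast Nat.card_pos.ne'
  let L : (G → ℂ) →+ ℂ :=
    { toFun := fun ξ => (Nat.card G : ℂ)⁻¹ * ∑ g, starRingEnd ℂ (ψ g) * ξ g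
      map_zero' := by simp
      map_add' := fun x y => by simp [mul_add, Finset.sum_add_distrib] }
  let ρ : Representation ℂ G (G → ℂ) :=
    { toFun := fun g => Matrix.toLin' ((Equiv.mulLeft g⁻¹).permMatrix ℂ)
      map_one' := by simp [Module.End.one_eq_id]
      map_mul' := fun x y => by
        rw [Module.End.mul_eq_comp, ← Matrix.toLin'_mul, ← Matrix.permMatrix_mul]
        congr 2
        ext z
        simp }
  have hρ : ∀ g, ρ.character g = if g = 1 then (Nat.card G : ℂ) else 0 := by
    intro g
    change LinearMap.trace ℂ _ (Matrix.toLin' ((Equiv.mulLeft g⁻¹).permMatrix ℂ)) = _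
    rw [Matrix.trace_toLin'_eq, Matrix.trace_permutation]
    split_ifs with hg
    · simp [hg, Function.fixedPoints, Function.IsFixedPt, Set.ncard_univ]
    · simp [hg, Function.fixedPoints, Function.IsFixedPt]
  have hLρ : L ρ.character ≠ 0 := by
    change (Nat.card G : ℂ)⁻¹ * ∑ g, starRingEnd ℂ (ψ g) * ρ.character g ≠ 0
    simp_rw [hρ]
    simpa [hc] using hψ
  obtain ⟨ξ, hξ, h⟩ := exists_isIrrChar_map_ne_zero L ρ hLρ
  refine ⟨ξ, hξ, fun h0 => h ?_⟩
  have := congrArg (starRingEnd ℂ) h0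
  rw [charInner_eq_sum] at this
  simpa [L, hc] using this

theorem IsChar.exists_matrix {G : Type} [Group G] {χ : G → ℂ} (h : IsChar G χ) :
    ∃ (d : ℕ) (X : G →* Matrix (Fin d) (Fin d) ℂ), ∀ g, χ g = (X g).trace := by
  obtain ⟨V, hV⟩ := h
  let b := Module.finBasis ℂ V
  refine ⟨_, (LinearMap.toMatrixAlgEquiv b).toMulEquiv.toMonoidHom.comp V.ρ, fun g => ?_⟩
  rw [hV, FDRep.character, LinearMap.trace_eq_matrix_trace ℂ b]
  rfl

theorem Nat.factorization_piPart (π : Set ℕ) (n p : ℕ) [Decidable (p ∈ π)] :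
    (Nat.piPart π n).factorization p = if p ∈ π then n.factorization p else 0 := by
  classical
  have h : Nat.piPart π n = (n.factorization.filter (· ∈ π)).prod (· ^ ·) := by
    rw [Finsupp.prod_filter_index, Finsupp.support_filter, Finset.prod_filter, Nat.piPart,
      Finsupp.prod]
  rw [h, Nat.prod_pow_factorization_eq_self, Finsupp.filter_apply]
  · congr
  · intro p hp
    rw [Finsupp.support_filter, Finset.mem_filter] at hp
    exact Nat.prime_of_mem_primeFactors hp.1

theorem Nat.piPart_ne_zero (π : Set ℕ) (n : ℕ) : Nat.piPart π n ≠ 0 := by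
  rw [Nat.piPart, Finsupp.prod, Finset.prod_ne_zero_iff]
  intro p hp
  split_ifs
  · exact pow_ne_zero _ (Nat.prime_of_mem_primeFactors hp).ne_zero
  · exact one_ne_zero

theorem Nat.mem_of_prime_dvd_piPart {π : Set ℕ} {n p : ℕ} (hp : p.Prime)
    (h : p ∣ Nat.piPart π n) : p ∈ π := by
  classical
  by_contra hπ
  have := hp.factorization_pos_of_dvd (Nat.piPart_ne_zero π n) h
  rw [Nat.factorization_piPart, if_neg hπ] at this
  exact this.false

theorem Nat.piPart_mul_piPart_compl (π : Set ℕ) {n : ℕ} (hn : n ≠ 0) :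
    Nat.piPart π n * Nat.piPart πᶜ n = n := by
  classical
  refine Nat.eq_of_factorization_eq
    (mul_ne_zero (Nat.piPart_ne_zero _ _) (Nat.piPart_ne_zero _ _)) hn fun p => ?_
  rw [Nat.factorization_mul (Nat.piPart_ne_zero _ _) (Nat.piPart_ne_zero _ _), Finsupp.add_apply,
    Nat.factorization_piPart, Nat.factorization_piPart]
  by_cases h : p ∈ π <;> simp [h]

theorem Nat.piPart_dvd_piPart (π : Set ℕ) {m n : ℕ} (hn : n ≠ 0) (h : m ∣ n) :
    Nat.piPart π m ∣ Nat.piPart π n := by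
  classical
  refine (Nat.factorization_le_iff_dvd (Nat.piPart_ne_zero _ _) (Nat.piPart_ne_zero _ _)).mp
    fun p => ?_
  rw [Nat.factorization_piPart, Nat.factorization_piPart]
  have := (Nat.factorization_le_iff_dvd (ne_zero_of_dvd_ne_zero hn h) hn).mpr h p
  split_ifs
  · exact this
  · exact le_rfl

theorem Nat.coprime_piPart {π : Set ℕ} {m n : ℕ} (h : ∀ p, p.Prime → p ∣ m → p ∉ π) :
    m.Coprime (Nat.piPart π n) :=
  Nat.coprime_of_dvd fun p hp hm hn => h p hp hm (Nat.mem_of_prime_dvd_piPart hp hn)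

theorem Nat.coprime_piPart_piPart_compl (π : Set ℕ) (n : ℕ) :
    (Nat.piPart π n).Coprime (Nat.piPart πᶜ n) :=
  Nat.coprime_piPart fun _ hp h => not_not.mpr (Nat.mem_of_prime_dvd_piPart hp h)

theorem elemPiPart_eq_pow {π : Set ℕ} {G : Type} [Group G] {g : G} {e s : ℕ} (he : e ≠ 0)
    (hg : orderOf g ∣ e) (h1 : s ≡ 1 [MOD Nat.piPart π e]) (h0 : s ≡ 0 [MOD Nat.piPart πᶜ e]) :
    elemPiPart π g = g ^ s := by
  have hn : orderOf g ≠ 0 := ne_zero_of_dvd_ne_zero he hg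
  have hmul := Nat.piPart_mul_piPart_compl π hn
  have hdiv : orderOf g / Nat.piPart π (orderOf g) = Nat.piPart πᶜ (orderOf g) := by
    exact Nat.div_eq_of_eq_mul_right (Nat.pos_of_ne_zero (Nat.piPart_ne_zero _ _)) hmul.symm
  have hcop := Nat.coprime_piPart_piPart_compl π (orderOf g)
  rw [elemPiPart, hdiv]
  refine pow_eq_pow_iff_modEq.mpr ?_
  rw [← hmul, ← Nat.modEq_and_modEq_iff_modEq_mul hcop]
  constructor
  · rw [hmul]
    exact (Nat.ModEq.pow_totient hcop.symm).trans
      (h1.of_dvd (Nat.piPart_dvd_piPart π he hg)).symm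
  · rw [hmul]
    refine Nat.ModEq.trans ?_ (h0.of_dvd (Nat.piPart_dvd_piPart πᶜ he hg)).symm
    refine Nat.modEq_zero_iff_dvd.mpr (dvd_pow_self _ ?_)
    exact (Nat.totient_pos.mpr (Nat.pos_of_ne_zero (Nat.piPart_ne_zero _ _))).ne'

theorem exists_elemPiPart_exponent (π : Set ℕ) {e : ℕ} (he : e ≠ 0) :
    ∃ s, s ≠ 0 ∧ s ≡ 1 [MOD Nat.piPart π e] ∧ s ≡ 0 [MOD Nat.piPart πᶜ e] := by
  obtain ⟨s, h1, h0⟩ := Nat.chineseRemainder (Nat.coprime_piPart_piPart_compl π e) 1 0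
  refine ⟨s + e, by omega, ?_, ?_⟩
  · refine Nat.ModEq.trans ?_ h1
    simpa using (Nat.ModEq.refl s).add (Nat.modEq_zero_iff_dvd.mpr
      (Dvd.intro _ (Nat.piPart_mul_piPart_compl π he)))
  · refine Nat.ModEq.trans ?_ h0
    simpa using (Nat.ModEq.refl s).add (Nat.modEq_zero_iff_dvd.mpr
      (Dvd.intro_left _ (Nat.piPart_mul_piPart_compl π he)))

theorem pow_eq_self_of_isPiNumber {π : Set ℕ} {G : Type} [Group G] {g : G} {e s : ℕ} (he : e ≠ 0)
    (hg : orderOf g ∣ e) (hπ : IsPiNumber π (orderOf g)) (h1 : s ≡ 1 [MOD Nat.piPart π e]) :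
    g ^ s = g := by
  have hcop : (orderOf g).Coprime (Nat.piPart πᶜ e) :=
    Nat.coprime_piPart fun p hp h => not_not.mpr (hπ p hp h)
  rw [← Nat.piPart_mul_piPart_compl π he] at hg
  conv_rhs => rw [← pow_one g]
  exact pow_eq_pow_iff_modEq.mpr (h1.of_dvd (hcop.dvd_of_dvd_mul_right hg))

theorem pow_eq_one_of_forall_notMem {π : Set ℕ} {G : Type} [Group G] {g : G} {e s : ℕ}
    (he : e ≠ 0) (hg : orderOf g ∣ e) (hπ : ∀ p, p.Prime → p ∣ orderOf g → p ∉ π)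
    (h0 : s ≡ 0 [MOD Nat.piPart πᶜ e]) : g ^ s = 1 := by
  rw [← Nat.piPart_mul_piPart_compl π he] at hg
  exact orderOf_dvd_iff_pow_eq_one.mp (((Nat.coprime_piPart hπ).dvd_of_dvd_mul_left hg).trans
    (Nat.modEq_zero_iff_dvd.mp h0))

theorem pow_mul_pow_eq_self {π : Set ℕ} {G : Type} [Group G] {g : G} {e s t : ℕ} (he : e ≠ 0)
    (hg : orderOf g ∣ e) (hs1 : s ≡ 1 [MOD Nat.piPart π e]) (hs0 : s ≡ 0 [MOD Nat.piPart πᶜ e])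
    (ht1 : t ≡ 1 [MOD Nat.piPart πᶜ e]) (ht0 : t ≡ 0 [MOD Nat.piPart π e]) :
    g ^ s * g ^ t = g := by
  rw [← pow_add]
  conv_rhs => rw [← pow_one g]
  refine pow_eq_pow_iff_modEq.mpr (Nat.ModEq.of_dvd hg ?_)
  rw [← Nat.piPart_mul_piPart_compl π he, ← Nat.modEq_and_modEq_iff_modEq_mul
    (Nat.coprime_piPart_piPart_compl π e)]
  exact ⟨hs1.add ht0, by simpa using hs0.add ht1⟩

theorem Matrix.trace_eq_trace_of_map_residue_eq {R n : Type*} [CommRing R] [IsLocalRing R]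
    [Fintype n] [DecidableEq n] {E E' : Matrix n n R} (hE : IsIdempotentElem E)
    (hE' : IsIdempotentElem E')
    (h : E.map (IsLocalRing.residue R) = E'.map (IsLocalRing.residue R)) :
    E.trace = E'.trace := by
  set F : Matrix n n R := E * E' + (1 - E) * (1 - E') with hF
  have hFunit : IsUnit F := by
    rw [Matrix.isUnit_iff_isUnit_det]
    refine (isUnit_map_iff (IsLocalRing.residue R) _).mp ?_
    have hmap : (IsLocalRing.residue R).mapMatrix F = 1 := by
      have h' : (IsLocalRing.residue R).mapMatrix E' = (IsLocalRing.residue R).mapMatrix E := h.symm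
      have hE1 : E * E = E := hE
      rw [hF, map_add, map_mul, map_mul, map_sub, map_sub, h', map_one, ← map_one
        (IsLocalRing.residue R).mapMatrix, ← map_sub, ← map_mul, ← map_mul, ← map_add]
      congr 1
      rw [hE.one_sub.eq, hE1, add_sub_cancel]
    rw [RingHom.map_det, hmap, Matrix.det_one]
    exact isUnit_one
  have hcomm : E * F = F * E' := by
    have h1 : E * E = E := hE
    have h2 : E' * E' = E' := hE'
    rw [hF]
    simp only [mul_add, add_mul, mul_sub, sub_mul, mul_one, one_mul, ← mul_assoc, h1]
    simp only [mul_assoc, h2]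
    abel
  obtain ⟨U, hU⟩ := hFunit
  have : E = U * E' * (U⁻¹ : (Matrix n n R)ˣ) := by
    rw [Units.eq_mul_inv_iff_mul_eq, hU, hcomm]
  rw [this, Matrix.trace_mul_cycle, Units.inv_mul, one_mul]

/-- The matrix, indexed by the left cosets of `A`, of left multiplication by an element of the
group algebra twisted by a linear character of `A`. -/
def Subgroup.twistedMatrix {Q R : Type*} [Group Q] [CommRing R] (A : Subgroup Q) [Fintype A]
    (ν : A → R) (e : Q → R) : Matrix (Q ⧸ A) (Q ⧸ A) R :=
  Matrix.of fun q r => ∑ a : A, ν a * e (q.out * a * r.out⁻¹)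

theorem Subgroup.sum_eq_sum_out_mul {Q R : Type*} [Group Q] [Fintype Q] [AddCommMonoid R]
    (A : Subgroup Q) [Fintype A] [Fintype (Q ⧸ A)] (F : Q → R) :
    ∑ x, F x = ∑ q : Q ⧸ A, ∑ a : A, F (q.out * a) := by
  rw [← Fintype.sum_prod_type' (fun (q : Q ⧸ A) (a : A) => F (q.out * a))]
  refine (Fintype.sum_bijective (fun p : (Q ⧸ A) × A => p.1.out * (p.2 : Q)) ⟨?_, ?_⟩ _ _
    fun _ => rfl).symm
  · rintro ⟨q, a⟩ ⟨r, b⟩ h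
    have hqr : q = r := by
      have := congrArg (QuotientGroup.mk : Q → Q ⧸ A) h
      simpa using this
    subst hqr
    simpa using h
  · intro x
    refine ⟨⟨QuotientGroup.mk x, ⟨(QuotientGroup.mk x : Q ⧸ A).out⁻¹ * x, ?_⟩⟩, by simp⟩
    rw [← QuotientGroup.eq]
    simp

theorem Subgroup.isIdempotentElem_twistedMatrix {Q R : Type*} [Group Q] [Fintype Q] [CommRing R]
    (A : Subgroup Q) [Fintype A] [Fintype (Q ⧸ A)] (ν : A →* R) {e : Q → R}
    (he : ∀ y, ∑ x, e x * e (x⁻¹ * y) = e y) : IsIdempotentElem (A.twistedMatrix ν e) := by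
  ext q r
  rw [Matrix.mul_apply]
  simp only [Subgroup.twistedMatrix, Matrix.of_apply, Finset.sum_mul_sum]
  calc ∑ s : Q ⧸ A, ∑ a : A, ∑ b : A,
        ν a * e (q.out * a * s.out⁻¹) * (ν b * e (s.out * b * r.out⁻¹))
      = ∑ s : Q ⧸ A, ∑ a : A, ∑ c : A, ν c *
        (e (q.out * (s.out * (a : Q))⁻¹) * e ((s.out * a) * (c * r.out⁻¹))) := by
        refine Finset.sum_congr rfl fun s _ => ?_
        rw [← Equiv.sum_comp (Equiv.inv A)]
        refine Finset.sum_congr rfl fun a _ => ?_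
        rw [← Equiv.sum_comp (Equiv.mulLeft a)]
        refine Finset.sum_congr rfl fun c _ => ?_
        have : ν c = ν a⁻¹ * ν (a * c) := by rw [← map_mul, inv_mul_cancel_left]
        rw [this]
        simp only [Equiv.inv_apply, Equiv.coe_mulLeft, Subgroup.coe_mul, Subgroup.coe_inv,
          mul_inv_rev, mul_assoc]
        ring
    _ = ∑ x : Q, ∑ c : A, ν c * (e (q.out * x⁻¹) * e (x * (c * r.out⁻¹))) :=
        (A.sum_eq_sum_out_mul fun x =>
          ∑ c : A, ν c * (e (q.out * x⁻¹) * e (x * (c * r.out⁻¹)))).symm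
    _ = ∑ c : A, ν c * ∑ x : Q, e (q.out * x⁻¹) * e (x * (c * r.out⁻¹)) := by
        rw [Finset.sum_comm]
        simp only [Finset.mul_sum]
    _ = _ := by
        refine Finset.sum_congr rfl fun c _ => ?_
        rw [← he (q.out * c * r.out⁻¹)]
        congr 1
        refine Fintype.sum_equiv ((Equiv.inv Q).trans (Equiv.mulLeft q.out)) _ _ fun x => ?_
        simp [mul_assoc]

theorem Subgroup.trace_twistedMatrix {Q R : Type*} [Group Q] [Fintype Q] [CommRing R]
    (A : Subgroup Q) [Fintype A] [Fintype (Q ⧸ A)] (ν : A → R) {e : Q → R}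
    (he : ∀ g x, e (g * x * g⁻¹) = e x) :
    (A.twistedMatrix ν e).trace = Fintype.card (Q ⧸ A) * ∑ a : A, ν a * e a := by
  simp [Matrix.trace, Subgroup.twistedMatrix, he]

theorem IsLocalRing.residue_eq_one_of_pow_eq_one {R : Type*} [CommRing R] [IsLocalRing R] {p : ℕ}
    (hp : p.Prime) (hpm : (p : R) ∈ IsLocalRing.maximalIdeal R) {x : R} (hx : x ^ p = 1) :
    IsLocalRing.residue R x = 1 := by
  have h0 : ((p : ℕ) : IsLocalRing.ResidueField R) = 0 := by
    rw [← map_natCast (IsLocalRing.residue R), IsLocalRing.residue_eq_zero_iff]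
    exact hpm
  have : Fact p.Prime := ⟨hp⟩
  have : CharP (IsLocalRing.ResidueField R) p :=
    (CharP.ringChar_of_prime_eq_zero hp h0) ▸ ringChar.charP _
  have h := sub_pow_char (R := IsLocalRing.ResidueField R) (p := p) (IsLocalRing.residue R x) 1
  rw [← map_pow, hx, map_one, one_pow, sub_self] at h
  exact sub_eq_zero.mp (pow_eq_zero_iff hp.ne_zero |>.mp h)

theorem Subgroup.sum_mul_eq_sum_mul_of_pow_eq_one {Q R : Type*} [Group Q] [Fintype Q] [CommRing R]
    [IsLocalRing R] [IsDomain R] [CharZero R] (A : Subgroup Q) [Fintype A] {p : ℕ} (hp : p.Prime)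
    (hpm : (p : R) ∈ IsLocalRing.maximalIdeal R) {e : Q → R}
    (he : ∀ y, ∑ x, e x * e (x⁻¹ * y) = e y) (hconj : ∀ g x, e (g * x * g⁻¹) = e x)
    (ν l : A →* R) (hl : ∀ a, l a ^ p = 1) :
    ∑ a : A, (ν a * l a) * e a = ∑ a : A, ν a * e a := by
  classical
  have : Fintype (Q ⧸ A) := Fintype.ofFinite _
  have key := Matrix.trace_eq_trace_of_map_residue_eq
    (A.isIdempotentElem_twistedMatrix (ν * l) he) (A.isIdempotentElem_twistedMatrix ν he) (by
      ext q r
      simp only [Matrix.map_apply, Subgroup.twistedMatrix, Matrix.of_apply, map_sum, map_mul,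
        MonoidHom.mul_apply]
      refine Finset.sum_congr rfl fun a _ => ?_
      rw [IsLocalRing.residue_eq_one_of_pow_eq_one hp hpm (hl a), mul_one])
  rw [A.trace_twistedMatrix _ hconj, A.trace_twistedMatrix _ hconj] at key
  exact mul_left_cancel₀ (by exact_mod_cast Fintype.card_ne_zero) key

theorem ValuationSubring.mem_of_pow_eq_one {K : Type*} [Field K] (O : ValuationSubring K) {z : K}
    {n : ℕ} (hn : n ≠ 0) (hz : z ^ n = 1) : z ∈ O := by
  rcases O.mem_or_inv_mem z with h | h
  · exact h
  · have : z = z⁻¹ ^ (n - 1) := by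
      rw [inv_pow]
      refine eq_inv_of_mul_eq_one_left ?_
      rw [← pow_succ', Nat.sub_add_cancel (Nat.pos_of_ne_zero hn), hz]
    rw [this]
    exact pow_mem h _

theorem AddChar.eq_zero_of_forall_sum_mul_eq_zero {A : Type*} [AddCommGroup A] [Fintype A]
    {h : A → ℂ} (hh : ∀ μ : AddChar A ℂ, ∑ a, μ a * h a = 0) (b : A) : h b = 0 := by
  classical
  have key : ∑ μ : AddChar A ℂ, μ (-b) * ∑ a, μ a * h a = 0 := by simp [hh]
  simp only [Finset.mul_sum] at key
  rw [Finset.sum_comm] at key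
  have h1 : ∀ a, ∑ μ : AddChar A ℂ, μ (-b) * (μ a * h a) =
      if a = b then (Fintype.card A : ℂ) * h a else 0 := by
    intro a
    have : ∀ μ : AddChar A ℂ, μ (-b) * (μ a * h a) = μ (a - b) * h a := fun μ => by
      rw [sub_eq_neg_add, AddChar.map_add_eq_mul, mul_assoc]
    simp_rw [this, ← Finset.sum_mul, AddChar.sum_apply_eq_ite, sub_eq_zero]
    split_ifs <;> simp
  simp_rw [h1] at key
  simpa using key

open scoped IsMulCommutative in
theorem eq_zero_of_convolution_idempotent {Q : Type*} [Group Q] [Fintype Q] (O : ValuationSubring ℂ)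
    {p : ℕ} (hp : p.Prime) (hpO : (p : ℂ) ∈ O.nonunits) {e : Q → ℂ} (heO : ∀ x, e x ∈ O)
    (he : ∀ y, ∑ x, e x * e (x⁻¹ * y) = e y) (hconj : ∀ g x, e (g * x * g⁻¹) = e x) {x : Q}
    (hx : p ∣ orderOf x) : e x = 0 := by
  classical
  let A := Subgroup.zpowers x
  have : Fintype A := Fintype.ofFinite A
  have : IsMulCommutative A := inferInstanceAs (IsMulCommutative (Subgroup.zpowers x))
  have hcard : ∀ a : Additive A, Nat.card A • a = 0 := fun a => by
    have := pow_card_eq_one' (x := a.toMul)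
    exact congrArg Additive.ofMul this
  have hμO : ∀ (μ : AddChar (Additive A) ℂ) (a : Additive A), μ a ∈ O := fun μ a =>
    O.mem_of_pow_eq_one (n := Nat.card A) Nat.card_pos.ne' (by
      rw [← AddChar.map_nsmul_eq_pow, hcard, AddChar.map_zero_eq_one])
  let toO : AddChar (Additive A) ℂ → (A →* O) := fun μ =>
    { toFun := fun a => ⟨μ (Additive.ofMul a), hμO _ _⟩
      map_one' := Subtype.ext (by simp)
      map_mul' := fun a b => Subtype.ext (by simp [AddChar.map_add_eq_mul]) }
  let e' : Q → O := fun y => ⟨e y, heO y⟩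
  have hpm : ((p : ℕ) : O) ∈ IsLocalRing.maximalIdeal O :=
    ValuationSubring.coe_mem_nonunits_iff.mp (by simpa using hpO)
  have hnA : Nat.card A = orderOf x := Nat.card_zpowers x
  let x' : A := ⟨x, Subgroup.mem_zpowers x⟩
  have hx' : (orderOf x / p) • Additive.ofMul x' ≠ 0 := by
    intro h0
    have h1 : x ^ (orderOf x / p) = 1 := congrArg (fun a : Additive A => ((a.toMul : A) : Q)) h0
    exact pow_ne_one_of_lt_orderOf (Nat.div_pos (Nat.le_of_dvd (orderOf_pos x) hx) hp.pos).ne'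
      (Nat.div_lt_self (orderOf_pos x) hp.one_lt) h1
  obtain ⟨ψ, hψ⟩ := (AddChar.exists_apply_ne_zero (α := Additive A)).mpr hx'
  let l : AddChar (Additive A) ℂ := ψ ^ (orderOf x / p)
  have hl : ∀ a, l a = ψ ((orderOf x / p) • a) := fun a => by
    rw [AddChar.map_nsmul_eq_pow, AddChar.pow_apply]
  have hlp : ∀ a : A, toO l a ^ p = 1 := fun a => by
    refine Subtype.ext ?_
    change l (Additive.ofMul a) ^ p = 1
    rw [← AddChar.map_nsmul_eq_pow, hl, smul_smul, Nat.div_mul_cancel hx, ← hnA, hcard,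
      AddChar.map_zero_eq_one]
  have key := AddChar.eq_zero_of_forall_sum_mul_eq_zero (A := Additive A)
    (h := fun a => (l a - 1) * e (a.toMul : A)) (fun μ => by
      have := A.sum_mul_eq_sum_mul_of_pow_eq_one hp hpm (e := e')
        (fun y => Subtype.ext (by simpa [e'] using he y)) (fun g y => Subtype.ext (hconj g y))
        (toO μ) (toO l) hlp
      have h2 : ∑ a : Additive A, (μ a * l a) * e (a.toMul : A) =
          ∑ a : Additive A, μ a * e (a.toMul : A) := by
        have hA : ∑ a : A, (μ (Additive.ofMul a) * l (Additive.ofMul a)) * e a =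
            ∑ a : A, μ (Additive.ofMul a) * e a := by
          simpa [e', toO] using congrArg (Subtype.val : O → ℂ) this
        rw [← Equiv.sum_comp Additive.ofMul fun a : Additive A => (μ a * l a) * e (a.toMul : A),
          ← Equiv.sum_comp Additive.ofMul fun a : Additive A => μ a * e (a.toMul : A)]
        exact hA
      rw [← sub_eq_zero, ← Finset.sum_sub_distrib] at h2
      rw [← h2]
      exact Finset.sum_congr rfl fun a _ => by ring) (Additive.ofMul x')
  refine (mul_eq_zero.mp key).resolve_left (sub_ne_zero.mpr ?_)
  rw [hl]
  exact hψ

theorem exists_valuationSubring_natCast_mem_nonunits {p : ℕ} (hp : p.Prime) :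
    ∃ O : ValuationSubring ℂ, (p : ℂ) ∈ O.nonunits := by
  let A : Subring ℂ := (Int.castRingHom ℂ).range
  have hpA : (p : ℂ) ∈ A := ⟨p, by simp⟩
  obtain ⟨O, -, hO⟩ := Ideal.image_subset_nonunits_valuationSubring
    (Ideal.span {(⟨p, hpA⟩ : A)}) (by
      rw [Ne, Ideal.span_singleton_eq_top, isUnit_iff_exists_inv]
      rintro ⟨⟨_, k, rfl⟩, h⟩
      have h1 : ((p * k : ℤ) : ℂ) = (1 : ℤ) := by simpa using congrArg (Subtype.val : A → ℂ) h
      have h2 : (p : ℤ) * k = 1 := by exact_mod_cast h1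
      have h3 := Int.isUnit_iff.mp (IsUnit.of_mul_eq_one _ h2)
      have := hp.one_lt
      omega)
  exact ⟨O, hO ⟨_, Ideal.subset_span rfl, rfl⟩⟩

theorem ValuationSubring.inv_natCast_mem {O : ValuationSubring ℂ} {p q : ℕ}
    (hpO : (p : ℂ) ∈ O.nonunits) (hpq : p.Coprime q) : (q : ℂ)⁻¹ ∈ O := by
  by_contra h
  have hq : (q : ℂ) ∈ O.nonunits := O.mem_nonunits_iff_or.mpr (Or.inr h)
  have hO : ∀ (a : ℂ) (k : ℤ), a ∈ O.nonunits → a * k ∈ O.nonunits := fun a k ha => by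
    rw [ValuationSubring.mem_nonunits_iff] at ha ⊢
    rw [map_mul]
    exact mul_lt_one_of_nonneg_of_lt_one_left zero_le ha
      ((O.valuation_le_one_iff _).mpr (intCast_mem O k))
  have h1 : ((p : ℂ) * p.gcdA q + q * p.gcdB q) ∈ O.nonunits :=
    O.nonunits.add_mem (hO _ _ hpO) (hO _ _ hq)
  have h2 : ((p : ℂ) * p.gcdA q + q * p.gcdB q) = 1 := by
    have := Nat.gcd_eq_gcd_ab p q
    rw [hpq.gcd_eq_one] at this
    exact_mod_cast this.symm
  rw [h2, ValuationSubring.mem_nonunits_iff, map_one] at h1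
  exact h1.false

theorem Representation.sum_character_mul_character {Q V : Type*} [Group Q] [Fintype Q]
    [AddCommGroup V] [Module ℂ V] [FiniteDimensional ℂ V] (ρ : Representation ℂ Q V)
    (h : (Nat.card Q : ℂ)⁻¹ * ∑ g, ρ.character g * ρ.character g⁻¹ = 1) (y : Q) :
    ρ.character 1 * ∑ x, ρ.character x⁻¹ * ρ.character (x * y) =
      Nat.card Q * ρ.character y := by
  have hc : (Nat.card Q : ℂ) ≠ 0 := by exact_mod_cast Nat.card_pos.ne'
  have : Invertible (Nat.card Q : ℂ) := invertibleOfNonzero hc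
  have hfin : Module.finrank ℂ (Representation.IntertwiningMap ρ ρ) = 1 := by
    have := Representation.card_inv_mul_sum_char_mul_char_eq_finrank ρ ρ
    rw [h] at this
    exact_mod_cast this.symm
  let T : Module.End ℂ V := ∑ x, ρ.character x⁻¹ • ρ x
  have hTy : ∀ y, LinearMap.trace ℂ V (T * ρ y) = ∑ x, ρ.character x⁻¹ * ρ.character (x * y) := by
    intro y
    simp [T, Finset.sum_mul, Representation.character]
  have hTcomm : ∀ g v, T (ρ g v) = ρ g (T v) := by
    intro g v
    have : T * ρ g = ρ g * T := by
      simp only [T, Finset.sum_mul, Finset.mul_sum, smul_mul_assoc, mul_smul_comm, ← map_mul]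
      refine Fintype.sum_equiv (MulAut.conj g⁻¹).toEquiv _ _ fun x => ?_
      have hx : ρ.character (g⁻¹ * (x⁻¹ * g)) = ρ.character x⁻¹ := by
        have := ρ.char_conj x⁻¹ g⁻¹
        rwa [inv_inv, mul_assoc] at this
      simp [hx, mul_assoc]
    exact LinearMap.congr_fun this v
  let T' : Representation.IntertwiningMap ρ ρ :=
    LinearMap.intertwiningMap_of_isIntertwiningMap _ _ T hTcomm
  have hone : (1 : Representation.IntertwiningMap ρ ρ) ≠ 0 := by
    intro h0
    have hs : Subsingleton V := ⟨fun v w => by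
      have hv : ∀ v : V, v = 0 := fun v =>
        congrArg (fun f : Representation.IntertwiningMap ρ ρ => f v) h0
      rw [hv v, hv w]⟩
    have : Subsingleton (Representation.IntertwiningMap ρ ρ) :=
      ⟨fun f g => by ext v; exact Subsingleton.elim _ _⟩
    rw [Module.finrank_zero_of_subsingleton] at hfin
    exact zero_ne_one hfin
  obtain ⟨c, hcT⟩ := (finrank_eq_one_iff_of_nonzero' _ hone).mp hfin T'
  have hT : T = c • 1 := by
    ext v
    exact (congrArg (fun f : Representation.IntertwiningMap ρ ρ => f v) hcT).symm
  have hval : ∀ y, ∑ x, ρ.character x⁻¹ * ρ.character (x * y) = c * ρ.character y := by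
    intro y
    rw [← hTy, hT, smul_mul_assoc, one_mul, map_smul, smul_eq_mul]
    rfl
  have h1 : c * ρ.character 1 = Nat.card Q := by
    rw [← hval]
    rw [inv_mul_eq_iff_eq_mul₀ hc, mul_one] at h
    rw [← h]
    exact Finset.sum_congr rfl fun x _ => by rw [mul_one, mul_comm]
  rw [hval, ← h1]
  ring

theorem Representation.character_mem {Q V : Type*} [Group Q] [Finite Q] [AddCommGroup V]
    [Module ℂ V] [FiniteDimensional ℂ V] (ρ : Representation ℂ Q V) (O : ValuationSubring ℂ)
    (x : Q) : ρ.character x ∈ O := by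
  have hQ : Nat.card Q ≠ 0 := Nat.card_pos.ne'
  obtain ⟨s, m, hs, h⟩ := exists_trace_pow_eq_sum (f := ρ x) hQ
    (by rw [← map_pow, pow_succ, pow_card_eq_one', one_mul])
  rw [Representation.character, ← pow_one (ρ x), h]
  refine sum_mem fun μ hμ => mul_mem (natCast_mem O _) (pow_mem ?_ 1)
  by_cases h0 : μ = 0
  · rw [h0]
    exact zero_mem O
  · refine O.mem_of_pow_eq_one hQ (mul_right_cancel₀ h0 ?_)
    rw [← pow_succ, hs μ hμ, one_mul]

theorem ValuationSubring.natCast_div_natCast_mem {O : ValuationSubring ℂ} {p m n : ℕ}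
    (hp : p.Prime) (hpO : (p : ℂ) ∈ O.nonunits) (hn : n ≠ 0)
    (h : m.factorization p = n.factorization p) : (m : ℂ) / n ∈ O := by
  have hm := Nat.ordProj_mul_ordCompl_eq_self m p
  have hn' := Nat.ordProj_mul_ordCompl_eq_self n p
  have hp0 : (p : ℂ) ^ n.factorization p ≠ 0 := pow_ne_zero _ (by exact_mod_cast hp.ne_zero)
  rw [h] at hm
  rw [← hm, ← hn']
  push_cast [Nat.cast_mul]
  rw [hn', mul_div_mul_left _ _ hp0, div_eq_mul_inv]
  exact O.mul_mem _ _ (natCast_mem O _)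
    (ValuationSubring.inv_natCast_mem hpO (Nat.coprime_ordCompl hp hn))

theorem eq_zero_of_mem_dzSet {π : Set ℕ} {Q : Type} [Group Q] [Finite Q] {χ : Q → ℂ}
    (hχ : χ ∈ dzSet π Q) {p : ℕ} (hp : p.Prime) (hpπ : p ∈ π) {x : Q} (hx : p ∣ orderOf x) :
    χ x = 0 := by
  classical
  have := Fintype.ofFinite Q
  obtain ⟨⟨⟨V, hV⟩, hnorm⟩, d, hd, hdπ⟩ := hχ
  let ρ : Representation ℂ Q V := V.ρ
  obtain rfl : χ = ρ.character := funext hV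
  have hc : (Nat.card Q : ℂ) ≠ 0 := by exact_mod_cast Nat.card_pos.ne'
  have hsum := ρ.sum_character_mul_character (by
    rw [charInner_eq_sum] at hnorm
    simpa only [Representation.character_inv] using hnorm)
  rw [hd] at hsum
  by_cases hd0 : (d : ℂ) = 0
  · have := hsum x
    rw [hd0, zero_mul, eq_comm, mul_eq_zero] at this
    exact this.resolve_left hc
  have hfact : d.factorization p = (Nat.card Q).factorization p := by
    have := congrArg (fun n => n.factorization p) hdπ
    simpa only [Nat.factorization_piPart, if_pos hpπ] using this
  obtain ⟨O, hpO⟩ := exists_valuationSubring_natCast_mem_nonunits hp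
  have key := eq_zero_of_convolution_idempotent O hp hpO (x := x⁻¹)
    (e := fun x => (d : ℂ) / Nat.card Q * ρ.character x⁻¹)
    (fun x => mul_mem (ValuationSubring.natCast_div_natCast_mem hp hpO Nat.card_pos.ne' hfact)
      (ρ.character_mem O _))
    (fun y => by
      have h1 : ∀ x, (d : ℂ) / Nat.card Q * ρ.character x⁻¹ *
          (d / Nat.card Q * ρ.character (x⁻¹ * y)⁻¹) =
          d / (Nat.card Q) ^ 2 * (d * (ρ.character x⁻¹ * ρ.character (x * y⁻¹))) := fun x => by
        rw [mul_inv_rev, inv_inv, ρ.char_mul_comm y⁻¹ x]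
        ring
      simp_rw [h1, ← Finset.mul_sum, hsum]
      field_simp)
    (fun g x => by
      have : (g * x * g⁻¹)⁻¹ = g * x⁻¹ * g⁻¹ := by group
      simp only [this, Representation.char_conj])
    (by rwa [orderOf_inv])
  simpa [hd0, hc] using key

theorem MonoidHom.inv_card_mul_sum_comp {A B : Type*} [Group A] [Group B] [Fintype A] [Fintype B]
    {f : A →* B} (hf : Function.Surjective f) (F : B → ℂ) :
    (Fintype.card A : ℂ)⁻¹ * ∑ a, F (f a) = (Fintype.card B : ℂ)⁻¹ * ∑ b, F b := by
  classical
  have hfib : ∀ b, (Finset.univ.filter fun a => f a = b).card =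
      (Finset.univ.filter fun a => f a = 1).card := fun b =>
    MonoidHom.card_fiber_eq_of_mem_range f (hf b) (hf 1)
  have hsum : ∀ F : B → ℂ, ∑ a, F (f a) =
      (Finset.univ.filter fun a => f a = 1).card * ∑ b, F b := fun F => by
    rw [← Finset.sum_fiberwise Finset.univ f, Finset.mul_sum]
    refine Finset.sum_congr rfl fun b _ => ?_
    rw [Finset.sum_congr rfl fun a ha => by rw [(Finset.mem_filter.mp ha).2], Finset.sum_const,
      hfib, nsmul_eq_mul]
  have hcard := hsum fun _ => 1
  simp only [Finset.sum_const, Finset.card_univ, nsmul_eq_mul, mul_one] at hcard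
  have hA : (Fintype.card A : ℂ) ≠ 0 := by exact_mod_cast Fintype.card_ne_zero
  have hB : (Fintype.card B : ℂ) ≠ 0 := by exact_mod_cast Fintype.card_ne_zero
  rw [hsum, inv_mul_eq_iff_eq_mul₀ hA, hcard]
  field_simp

theorem exists_int_sum_trace_mul_average {H K m n : Type*} [Group H] [Fintype H] [Group K]
    [Fintype K] [Fintype m] [DecidableEq m] [Fintype n] [DecidableEq n]
    (A : H →* Matrix m m ℂ) (D : H →* Matrix n n ℂ) (Ω : K →* Matrix n n ℂ)
    (hcomm : ∀ k h, Commute (Ω k) (D h)) {t : ℕ} (ht : t ≠ 0) :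
    ∃ z : ℤ, (Fintype.card H : ℂ)⁻¹ * ∑ h, (A h).trace *
      ((Fintype.card K : ℂ)⁻¹ * ∑ k, (Ω k * D (h ^ t)).trace) = z := by
  have hK : (Fintype.card K : ℂ) ≠ 0 := by exact_mod_cast Fintype.card_ne_zero
  set P : Matrix n n ℂ := (Fintype.card K : ℂ)⁻¹ • ∑ k, Ω k with hP
  have hΩP : ∀ k, Ω k * P = P := fun k => by
    rw [hP, Matrix.mul_smul, Finset.mul_sum]
    congr 1
    exact Fintype.sum_equiv (Equiv.mulLeft k) _ _ fun x => (map_mul Ω k x).symm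
  have hPP : P * P = P := by
    conv_lhs => enter [1]; rw [hP]
    rw [Matrix.smul_mul, Finset.sum_mul, Finset.sum_congr rfl fun k _ => hΩP k, Finset.sum_const,
      Finset.card_univ, ← Nat.cast_smul_eq_nsmul ℂ, inv_smul_smul₀ hK]
  have hPD : ∀ h, Commute P (D h) := fun h =>
    (Commute.sum_left _ _ _ fun k _ => hcomm k h).smul_left _
  let B : H →ₙ* Matrix n n ℂ :=
    { toFun := fun h => P * D h
      map_mul' := fun x y => by
        rw [map_mul, mul_assoc, ← mul_assoc (D x), ← (hPD x).eq, mul_assoc P, ← mul_assoc P P,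
          hPP] }
  obtain ⟨z, hz⟩ := exists_int_sum_trace_mul_trace_pow (A : H →ₙ* Matrix m m ℂ) B ht
  refine ⟨z, hz ▸ ?_⟩
  congr 1
  refine Finset.sum_congr rfl fun h _ => ?_
  congr 1
  change _ = (P * D (h ^ t)).trace
  rw [hP, Matrix.smul_mul, Matrix.trace_smul, Finset.sum_mul, Matrix.trace_sum, smul_eq_mul]

open scoped Kronecker in
theorem IsChar.exists_int_sum_centralizer {G : Type} [Group G] [Finite G] {N : Subgroup G}
    [N.Normal] [Fintype N] [Fintype (Subgroup.centralizer (N : Set G))] {θ : N → ℂ}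
    {χ : G ⧸ N → ℂ} {ξ : G → ℂ} (hθ : IsChar N θ) (hχ : IsChar (G ⧸ N) χ) (hξ : IsChar G ξ) {t : ℕ}
    (ht : t ≠ 0) :
    ∃ z : ℤ, (Fintype.card (Subgroup.centralizer (N : Set G)) : ℂ)⁻¹ *
      ∑ c : Subgroup.centralizer (N : Set G), χ (c : G) *
        ((Fintype.card N : ℂ)⁻¹ * ∑ n : N, θ n * starRingEnd ℂ (ξ (n * (c : G) ^ t))) = z := by
  obtain ⟨a, X, hX⟩ := hχ.exists_matrix
  obtain ⟨b, Θ, hΘ⟩ := hθ.exists_matrix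
  obtain ⟨d, Ξ, hΞ⟩ := hξ.exists_matrix
  let conj {n : ℕ} : Matrix (Fin n) (Fin n) ℂ →* Matrix (Fin n) (Fin n) ℂ :=
    (starRingEnd ℂ).mapMatrix.toMonoidHom
  have hconj : ∀ {n : ℕ} (M : Matrix (Fin n) (Fin n) ℂ),
      (conj M).trace = starRingEnd ℂ M.trace := fun M => by
    simp [conj, Matrix.trace]
  let A : Subgroup.centralizer (N : Set G) →* Matrix (Fin a) (Fin a) ℂ :=
    X.comp ((QuotientGroup.mk' N).comp (Subgroup.centralizer (N : Set G)).subtype)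
  let D : Subgroup.centralizer (N : Set G) →* Matrix (Fin b × Fin d) (Fin b × Fin d) ℂ :=
    { toFun := fun c => (1 : Matrix (Fin b) (Fin b) ℂ) ⊗ₖ conj (Ξ c)
      map_one' := by simp
      map_mul' := fun x y => by
        rw [← Matrix.mul_kronecker_mul, one_mul, Subgroup.coe_mul, map_mul, map_mul] }
  let Ω : N →* Matrix (Fin b × Fin d) (Fin b × Fin d) ℂ :=
    { toFun := fun n => Θ n ⊗ₖ conj (Ξ n)
      map_one' := by simp
      map_mul' := fun x y => by
        rw [← Matrix.mul_kronecker_mul, Subgroup.coe_mul, map_mul, map_mul, map_mul] }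
  obtain ⟨z, hz⟩ := exists_int_sum_trace_mul_average A D Ω (fun n c => by
    change Θ n ⊗ₖ conj (Ξ n) * (1 ⊗ₖ conj (Ξ c)) = 1 ⊗ₖ conj (Ξ c) * (Θ n ⊗ₖ conj (Ξ n))
    rw [← Matrix.mul_kronecker_mul, ← Matrix.mul_kronecker_mul, mul_one, one_mul, ← map_mul,
      ← map_mul, ← map_mul, ← map_mul, Subgroup.mem_centralizer_iff.mp c.2 n n.2]) ht
  refine ⟨z, hz ▸ ?_⟩
  congr 1
  refine Finset.sum_congr rfl fun c _ => ?_
  rw [hX]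
  congr 2
  refine Finset.sum_congr rfl fun n _ => ?_
  change _ = (Θ n ⊗ₖ conj (Ξ n) * (1 ⊗ₖ conj (Ξ _))).trace
  rw [← Matrix.mul_kronecker_mul, mul_one, ← map_mul, ← map_mul, Matrix.trace_kronecker, hconj,
    hΘ, hΞ, Subgroup.coe_pow]

theorem IsChar.exists_natCast_eq {G : Type} [Group G] [Finite G] {χ : G → ℂ}
    (h : IsChar G χ) : ∃ d : ℕ, χ 1 = d := by
  obtain ⟨d, X, hX⟩ := h.exists_matrix
  exact ⟨d, by rw [hX, map_one, Matrix.trace_one, Fintype.card_fin]⟩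

theorem IsIrrChar.map_one_ne_zero {G : Type} [Group G] [Finite G] {χ : G → ℂ}
    (h : IsIrrChar G χ) : χ 1 ≠ 0 := by
  have := Fintype.ofFinite G
  obtain ⟨d, X, hX⟩ := h.1.exists_matrix
  intro h0
  rw [hX, map_one, Matrix.trace_one, Fintype.card_fin, Nat.cast_eq_zero] at h0
  subst h0
  have hχ : ∀ g, χ g = 0 := fun g => by rw [hX]; simp [Matrix.trace]
  simpa [charInner_eq_sum, hχ] using h.2

/-- A function of norm one having integral inner products with all irreducible characters, and a
positive integer as value at `1`, is an irreducible character. -/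
theorem isIrrChar_of_forall_exists_int {G : Type} [Group G] [Finite G] {ψ : G → ℂ}
    (hnorm : charInner G ψ ψ = 1) (hint : ∀ ξ, IsIrrChar G ξ → ∃ z : ℤ, charInner G ψ ξ = z)
    {k : ℕ} (hk : k ≠ 0) (h1 : ψ 1 = k) : IsIrrChar G ψ := by
  have := Fintype.ofFinite G
  have hc : (Nat.card G : ℂ) ≠ 0 := by exact_mod_cast Nat.card_pos.ne'
  obtain ⟨ξ, hξ, hne⟩ := exists_isIrrChar_charInner_ne_zero ψ (by rw [h1]; exact_mod_cast hk)
  obtain ⟨z, hz⟩ := hint ξ hξ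
  have hz0 : z ≠ 0 := by rintro rfl; exact hne (by simpa using hz)
  have hz' : charInner G ξ ψ = z := by
    rw [charInner_eq_sum] at hz ⊢
    have := congrArg (starRingEnd ℂ) hz
    simpa [mul_comm] using this
  have hexp : charInner G (fun g => ψ g - z * ξ g) (fun g => ψ g - z * ξ g) = 1 - (z : ℂ) ^ 2 := by
    have hξ2 := hξ.2
    rw [charInner_eq_sum] at hz hz' hnorm hξ2 ⊢
    have : ∀ g, (ψ g - z * ξ g) * starRingEnd ℂ (ψ g - z * ξ g) =
        ψ g * starRingEnd ℂ (ψ g) - z * (ψ g * starRingEnd ℂ (ξ g)) -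
          z * (ξ g * starRingEnd ℂ (ψ g)) + z ^ 2 * (ξ g * starRingEnd ℂ (ξ g)) := fun g => by
      simp only [map_sub, map_mul, map_intCast]
      ring
    simp_rw [this, Finset.sum_add_distrib, Finset.sum_sub_distrib, ← Finset.mul_sum]
    linear_combination hnorm - (z : ℂ) * hz - z * hz' + z ^ 2 * hξ2
  rw [charInner_eq_sum, inv_mul_eq_iff_eq_mul₀ hc] at hexp
  simp_rw [Complex.mul_conj] at hexp
  have hreal : ∑ g, Complex.normSq (ψ g - z * ξ g) = Nat.card G * (1 - (z : ℝ) ^ 2) := by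
    exact_mod_cast hexp
  have hpos : 0 < (Nat.card G : ℝ) := by exact_mod_cast Nat.card_pos
  have hnn : 0 ≤ ∑ g, Complex.normSq (ψ g - z * ξ g) :=
    Finset.sum_nonneg fun _ _ => Complex.normSq_nonneg _
  have hz1 : z ^ 2 = 1 := by
    have hle : (z : ℝ) ^ 2 ≤ 1 := by
      rw [hreal] at hnn
      linarith [nonneg_of_mul_nonneg_right hnn hpos]
    have hle' : z ^ 2 ≤ 1 := by exact_mod_cast hle
    have : 0 < z ^ 2 := by positivity
    omega
  have heq : ∀ g, ψ g = z * ξ g := fun g => by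
    have h0 : ∑ g, Complex.normSq (ψ g - z * ξ g) = 0 := by
      rw [hreal, show (z : ℝ) ^ 2 = 1 by exact_mod_cast hz1]
      simp
    have := (Finset.sum_eq_zero_iff_of_nonneg fun _ _ => Complex.normSq_nonneg _).mp h0 g
      (Finset.mem_univ g)
    exact sub_eq_zero.mp (Complex.normSq_eq_zero.mp this)
  obtain ⟨d, hd⟩ := hξ.1.exists_natCast_eq
  have hkd : (k : ℤ) = z * d := by
    have := heq 1
    rw [h1, hd] at this
    exact_mod_cast this
  rcases mul_self_eq_one_iff.mp ((sq z).symm.trans hz1) with rfl | rfl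
  · convert hξ using 1
    funext g
    simp [heq g]
  · omega

theorem surjective_noncommCoprod_centralizer {G : Type*} [Group G] {N : Subgroup G} [N.Normal]
    (hGC : N ⊔ Subgroup.centralizer (N : Set G) = ⊤) :
    ∃ f : N × Subgroup.centralizer (N : Set G) →* G,
      Function.Surjective f ∧ ∀ x, f x = x.1 * x.2 := by
  refine ⟨N.subtype.noncommCoprod (Subgroup.centralizer (N : Set G)).subtype fun n c =>
    Subgroup.mem_centralizer_iff.mp c.2 n n.2, fun g => ?_, fun _ => rfl⟩
  obtain ⟨n, hn, c, hc, rfl⟩ := Subgroup.mem_sup_of_normal_left.mp (hGC.symm ▸ Subgroup.mem_top g :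
    g ∈ N ⊔ Subgroup.centralizer (N : Set G))
  exact ⟨(⟨n, hn⟩, ⟨c, hc⟩), rfl⟩

theorem surjective_mk_centralizer {G : Type*} [Group G] {N : Subgroup G} [N.Normal]
    (hGC : N ⊔ Subgroup.centralizer (N : Set G) = ⊤) :
    Function.Surjective
      ((QuotientGroup.mk' N).comp (Subgroup.centralizer (N : Set G)).subtype) := by
  intro q
  obtain ⟨g, rfl⟩ := QuotientGroup.mk'_surjective N q
  obtain ⟨n, hn, c, hc, rfl⟩ := Subgroup.mem_sup_of_normal_left.mp (hGC.symm ▸ Subgroup.mem_top g :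
    g ∈ N ⊔ Subgroup.centralizer (N : Set G))
  refine ⟨⟨c, hc⟩, ?_⟩
  simp [(QuotientGroup.eq_one_iff n).mpr hn]

theorem charInner_eq_sum_centralizer {G : Type} [Group G] [Finite G] {N : Subgroup G} [N.Normal]
    [Fintype N] [Fintype (Subgroup.centralizer (N : Set G))]
    (hGC : N ⊔ Subgroup.centralizer (N : Set G) = ⊤) {θ : N → ℂ} {χ : G ⧸ N → ℂ} {ψ : G → ℂ}
    {a : Subgroup.centralizer (N : Set G) → N}
    (hψ : ∀ (n : N) (c : Subgroup.centralizer (N : Set G)),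
      ψ (n * c) = θ (n * a c) * χ (c : G)) (φ : G → ℂ) :
    charInner G ψ φ = (Fintype.card (Subgroup.centralizer (N : Set G)) : ℂ)⁻¹ *
      ∑ c : Subgroup.centralizer (N : Set G), χ (c : G) *
        ((Fintype.card N : ℂ)⁻¹ * ∑ n : N, θ n * starRingEnd ℂ (φ (n * (a c : G)⁻¹ * c))) := by
  have := Fintype.ofFinite G
  obtain ⟨f, hf, hfx⟩ := surjective_noncommCoprod_centralizer hGC
  rw [charInner_eq_sum, Nat.card_eq_fintype_card, ← MonoidHom.inv_card_mul_sum_comp hf,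
    Fintype.card_prod, Fintype.sum_prod_type_right, Nat.cast_mul, mul_inv, mul_comm (_⁻¹) (_⁻¹),
    mul_assoc, Finset.mul_sum]
  congr 1
  refine Finset.sum_congr rfl fun c _ => ?_
  rw [mul_left_comm, Finset.mul_sum _ _ (χ _)]
  congr 1
  refine Fintype.sum_equiv (Equiv.mulRight (a c)) _ _ fun n => ?_
  rw [hfx, hψ]
  simp only [Equiv.coe_mulRight, Subgroup.coe_mul, mul_inv_cancel_right]
  ring

theorem isIrrChar_of_eq_mul {G : Type} [Group G] [Finite G] {N : Subgroup G} [N.Normal]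
    (hGC : N ⊔ Subgroup.centralizer (N : Set G) = ⊤) {θ : N → ℂ} (hθ : IsIrrChar N θ)
    {χ : G ⧸ N → ℂ} (hχ : IsIrrChar (G ⧸ N) χ) {ψ : G → ℂ} (h1 : ψ 1 = θ 1 * χ 1)
    {a : Subgroup.centralizer (N : Set G) → N} {t : ℕ} (ht : t ≠ 0)
    (hψ : ∀ (n : N) (c : Subgroup.centralizer (N : Set G)),
      ψ (n * c) = θ (n * a c) * χ (c : G))
    (ha : ∀ c : Subgroup.centralizer (N : Set G), χ (c : G) ≠ 0 → (a c : G) * (c : G) ^ t = c) :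
    IsIrrChar G ψ := by
  have := Fintype.ofFinite G
  have := Fintype.ofFinite N
  have := Fintype.ofFinite (G ⧸ N)
  have := Fintype.ofFinite (Subgroup.centralizer (N : Set G))
  obtain ⟨k, hk⟩ := hθ.1.exists_natCast_eq
  obtain ⟨l, hl⟩ := hχ.1.exists_natCast_eq
  have hk0 : k ≠ 0 := fun h => hθ.map_one_ne_zero (by rw [hk, h, Nat.cast_zero])
  have hl0 : l ≠ 0 := fun h => hχ.map_one_ne_zero (by rw [hl, h, Nat.cast_zero])
  refine isIrrChar_of_forall_exists_int ?_ (fun ξ hξ => ?_) (mul_ne_zero hk0 hl0)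
    (by rw [h1, hk, hl, Nat.cast_mul])
  · have hθ1 := hθ.2
    have hχ1 := hχ.2
    rw [charInner_eq_sum, Nat.card_eq_fintype_card] at hθ1 hχ1
    rw [← MonoidHom.inv_card_mul_sum_comp (surjective_mk_centralizer hGC)] at hχ1
    rw [charInner_eq_sum_centralizer hGC hψ, ← hχ1]
    congr 1
    refine Finset.sum_congr rfl fun c _ => ?_
    have : ∀ n : N, θ n * starRingEnd ℂ (ψ (n * (a c : G)⁻¹ * c)) =
        θ n * starRingEnd ℂ (θ n) * starRingEnd ℂ (χ (c : G)) := fun n => by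
      have := hψ (n * (a c)⁻¹) c
      rw [inv_mul_cancel_right, Subgroup.coe_mul, Subgroup.coe_inv] at this
      rw [this, map_mul, mul_assoc]
    simp_rw [this, ← Finset.sum_mul]
    rw [← mul_assoc (_⁻¹), hθ1, one_mul]
    rfl
  · obtain ⟨z, hz⟩ := hθ.1.exists_int_sum_centralizer hχ.1 hξ.1 ht
    refine ⟨z, hz ▸ ?_⟩
    rw [charInner_eq_sum_centralizer hGC hψ]
    congr 1
    refine Finset.sum_congr rfl fun c _ => ?_
    by_cases hc : χ (c : G) = 0
    · rw [hc, zero_mul, zero_mul]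
    congr 2
    refine Finset.sum_congr rfl fun n _ => ?_
    rw [mul_assoc (n : G), inv_mul_eq_of_eq_mul (ha c hc).symm]

theorem elemPiPart_one (π : Set ℕ) (G : Type) [Group G] : elemPiPart π (1 : G) = 1 :=
  one_pow _

open Classical in
theorem psi_irreducible_relative_defect_zero_when_G_eq_N_centralizer
    {G : Type} [Group G] [Finite G] (π : Set ℕ) (N : Subgroup G) [N.Normal]
    (hNpi : IsPiNumber π (Nat.card ↥N))
    (θ : ↥N → ℂ) (hθ : IsIrrChar ↥N θ) (hinv : IsGInvariant N θ)
    (hGC : N ⊔ Subgroup.centralizer (N : Set G) = ⊤)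
    (χ : G ⧸ N → ℂ) (hχ : χ ∈ dzSet π (G ⧸ N)) :
    IsIrrChar G (fun g : G =>
      if h : elemPiPart π g ∈ N then
        θ ⟨elemPiPart π g, h⟩ * χ ((elemPiPart πᶜ g : G) : G ⧸ N)
      else 0) ∧
    ∃ m : ℕ,
      (if h : elemPiPart π (1 : G) ∈ N then
        θ ⟨elemPiPart π (1 : G), h⟩ * χ ((elemPiPart πᶜ (1 : G) : G) : G ⧸ N)
      else 0) = θ 1 * (m : ℂ) ∧
      Nat.piPart π m = Nat.piPart π N.index := by
  classical
  have hdiv : ∀ g : G, orderOf g ∣ Nat.card G := orderOf_dvd_natCard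
  have he : Nat.card G ≠ 0 := Nat.card_pos.ne'
  obtain ⟨s, hs, hs1, hs0⟩ := exists_elemPiPart_exponent π he
  obtain ⟨t, ht, ht1, ht0⟩ := exists_elemPiPart_exponent πᶜ he
  have ht0' := ht0
  rw [compl_compl] at ht0'
  have hπs : ∀ g : G, elemPiPart π g = g ^ s := fun g => elemPiPart_eq_pow he (hdiv g) hs1 hs0
  have hπt : ∀ g : G, elemPiPart πᶜ g = g ^ t := fun g => elemPiPart_eq_pow he (hdiv g) ht1 ht0
  have hst : ∀ g : G, g ^ s * g ^ t = g := fun g =>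
    pow_mul_pow_eq_self he (hdiv g) hs1 hs0 ht1 ht0'
  have hN : ∀ n : N, IsPiNumber π (orderOf (n : G)) := fun n p hp h =>
    hNpi p hp (h.trans (N.orderOf_dvd_natCard n.2))
  have hns : ∀ n : N, (n : G) ^ s = n := fun n => pow_eq_self_of_isPiNumber he (hdiv _) (hN n) hs1
  have hnt : ∀ n : N, (n : G) ^ t = 1 := fun n =>
    pow_eq_one_of_forall_notMem (π := πᶜ) he (hdiv _) (fun p hp h h' => h' (hN n p hp h)) ht0
  have hcomm : ∀ (n : N) (c : Subgroup.centralizer (N : Set G)), Commute (n : G) c := fun n c =>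
    Subgroup.mem_centralizer_iff.mp c.2 n n.2
  have hone : (if h : elemPiPart π (1 : G) ∈ N then
      θ ⟨elemPiPart π (1 : G), h⟩ * χ ((elemPiPart πᶜ (1 : G) : G) : G ⧸ N) else 0) =
      θ 1 * χ 1 := by
    have h1 : elemPiPart π (1 : G) ∈ N := by
      rw [elemPiPart_one]
      exact N.one_mem
    rw [dif_pos h1, elemPiPart_one πᶜ]
    congr 2
    exact Subtype.ext (elemPiPart_one π G)
  have hvanish : ∀ g : G, g ^ s ∉ N → χ g = 0 := fun g hg => by
    have hdivQ : orderOf (g : G ⧸ N) ∣ Nat.card G :=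
      (orderOf_map_dvd (QuotientGroup.mk' N) g).trans (hdiv g)
    by_contra hne
    refine hg ((QuotientGroup.eq_one_iff _).mp ?_)
    rw [QuotientGroup.mk_pow]
    exact pow_eq_one_of_forall_notMem he hdivQ
      (fun p hp h hpπ => hne (eq_zero_of_mem_dzSet hχ hp hpπ h)) hs0
  refine ⟨isIrrChar_of_eq_mul hGC hθ hχ.1 hone ht
    (a := fun c => if h : (c : G) ^ s ∈ N then ⟨(c : G) ^ s, h⟩ else 1) (fun n c => ?_)
    (fun c hc => ?_), ?_⟩
  · have hs' : elemPiPart π ((n : G) * c) = n * (c : G) ^ s := by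
      rw [hπs, (hcomm n c).mul_pow, hns]
    have ht' : elemPiPart πᶜ ((n : G) * c) = (c : G) ^ t := by
      rw [hπt, (hcomm n c).mul_pow, hnt, one_mul]
    have hmem : elemPiPart π ((n : G) * c) ∈ N ↔ (c : G) ^ s ∈ N := by
      rw [hs']
      exact N.mul_mem_cancel_left n.2
    by_cases h : (c : G) ^ s ∈ N
    · have hc : (((c : G) ^ t : G) : G ⧸ N) = (c : G) := by
        conv_rhs => rw [← hst c, QuotientGroup.mk_mul, (QuotientGroup.eq_one_iff _).mpr h, one_mul]
      rw [dif_pos (hmem.mpr h), dif_pos h, ht', hc]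
      congr 2
      exact Subtype.ext hs'
    · rw [dif_neg (mt hmem.mp h), hvanish c h, mul_zero]
  · rw [dif_pos (by_contra fun h => hc (hvanish c h))]
    exact hst c
  · obtain ⟨d, hd, hdπ⟩ := hχ.2
    exact ⟨d, by rw [hone, hd], hdπ⟩
end
end

section
/- Let G be a finite group, N ⊴ G, θ ∈ Irr(N) G-invariant, and suppose the order of [θ]_{G/N} ∈ H²(G/N,ℂ^×) equals n. Then there exists a character triple (G*, N*, θ*) isomorphic to (G,N,θ) in which N* is a cyclic central subgroup of G* of order n and θ* is a faithful linear character of N*. -/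
open scoped BigOperators
noncomputable section

def IsTwoCocycle {Q : Type} [Group Q] (a : Q → Q → ℂˣ) : Prop :=
  ∀ x y z : Q, a x y * a (x * y) z = a y z * a x (y * z)

def IsTwoCoboundary {Q : Type} [Group Q] (a : Q → Q → ℂˣ) : Prop :=
  ∃ ν : Q → ℂˣ, ∀ x y : Q, a x y = ν x * ν y * (ν (x * y))⁻¹

/-- The order of the cohomology class of a 2-cocycle `a` in `H²(Q, ℂˣ)`:
the least positive `m` such that `a^m` is a coboundary. -/
def cocycleClassOrder {Q : Type} [Group Q] (a : Q → Q → ℂˣ) : ℕ :=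
  sInf {m | 0 < m ∧ IsTwoCoboundary fun x y => a x y ^ m}

/-- The data of a projective representation of `G` associated with the character
triple `(G, N, θ)`, with factor set inflated from a 2-cocycle on `G ⧸ N`
(Isaacs, Theorem 11.2): its cohomology class is `[θ]_{G/N}`. -/
structure ProjRepOfTriple (G : Type) [Group G] (N : Subgroup G) [N.Normal]
    (θ : ↥N → ℂ) where
  d : ℕ
  X : G → Matrix (Fin d) (Fin d) ℂ
  a : G ⧸ N → G ⧸ N → ℂˣ
  cocycle : IsTwoCocycle a
  factor : ∀ g h : G, X g * X h = (a (g : G ⧸ N) (h : G ⧸ N) : ℂ) • X (g * h)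
  map_one : X 1 = 1
  unit : ∀ g : G, IsUnit (X g)
  traceN : ∀ n : ↥N, Matrix.trace (X (n : G)) = θ n
  mulN_left : ∀ (n : ↥N) (g : G), X ((n : G) * g) = X (n : G) * X g
  mulN_right : ∀ (n : ↥N) (g : G), X (g * (n : G)) = X g * X (n : G)

/-- The subgroup of `G'` corresponding to `N ≤ H ≤ G` under an isomorphism
`τ : G/N ≃* G'/N'`, i.e. the full preimage in `G'` of `τ(H/N)`. -/
def corrSubgroup {G G' : Type} [Group G] [Group G'] (N : Subgroup G) [N.Normal]
    (N' : Subgroup G') [N'.Normal] (τ : (G ⧸ N) ≃* (G' ⧸ N')) (H : Subgroup G) :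
    Subgroup G' :=
  Subgroup.comap (QuotientGroup.mk' N') (Subgroup.map τ.toMonoidHom
    (Subgroup.map (QuotientGroup.mk' N) H))

lemma corrSubgroup_mono {G G' : Type} [Group G] [Group G'] (N : Subgroup G)
    [N.Normal] (N' : Subgroup G') [N'.Normal] (τ : (G ⧸ N) ≃* (G' ⧸ N'))
    {K H : Subgroup G} (hKH : K ≤ H) :
    corrSubgroup N N' τ K ≤ corrSubgroup N N' τ H :=
  Subgroup.comap_mono (Subgroup.map_mono (Subgroup.map_mono hKH))

lemma le_corrSubgroup {G G' : Type} [Group G] [Group G'] (N : Subgroup G)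
    [N.Normal] (N' : Subgroup G') [N'.Normal] (τ : (G ⧸ N) ≃* (G' ⧸ N'))
    (H : Subgroup G) : N' ≤ corrSubgroup N N' τ H := by
  intro x hx
  have h1 : QuotientGroup.mk' N' x = 1 := by
    simpa [MonoidHom.mem_ker, QuotientGroup.ker_mk'] using hx
  simp only [corrSubgroup, Subgroup.mem_comap, h1]
  exact Subgroup.one_mem _

/-- `χ` is an irreducible character of `H` lying over `θ ∈ Irr N`, for `N ≤ H`. -/
def IsIrrOver {G : Type} [Group G] {N H : Subgroup G} (hNH : N ≤ H)
    (θ : ↥N → ℂ) (χ : ↥H → ℂ) : Prop :=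
  IsIrrChar ↥H χ ∧
    charInner ↥N (fun n : ↥N => χ (Subgroup.inclusion hNH n)) θ ≠ 0

/-- An isomorphism of character triples `(G,N,θ) → (G',N',θ')` in the sense of
Isaacs (Character Theory, Definition 11.23). -/
structure CharTripleIso (G : Type) [Group G] (N : Subgroup G) [N.Normal]
    (θ : ↥N → ℂ) (G' : Type) [Group G'] (N' : Subgroup G') [N'.Normal]
    (θ' : ↥N' → ℂ) where
  τ : (G ⧸ N) ≃* (G' ⧸ N')
  σ : ∀ H : Subgroup G, N ≤ H → (↥H → ℂ) → (↥(corrSubgroup N N' τ H) → ℂ)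
  bij : ∀ (H : Subgroup G) (hNH : N ≤ H),
    Set.BijOn (σ H hNH) {χ | IsIrrOver hNH θ χ}
      {χ' | IsIrrOver (le_corrSubgroup N N' τ H) θ' χ'}
  inner_res : ∀ (H : Subgroup G) (hNH : N ≤ H) (K : Subgroup G) (hNK : N ≤ K)
      (hKH : K ≤ H) (χ ψ : _),
    IsIrrOver hNH θ χ → IsIrrOver hNK θ ψ →
    charInner ↥K (fun k : ↥K => χ (Subgroup.inclusion hKH k)) ψ =
      charInner ↥(corrSubgroup N N' τ K)
        (fun k => σ H hNH χ (Subgroup.inclusion (corrSubgroup_mono N N' τ hKH) k))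
        (σ K hNK ψ)
  mul_compat : ∀ (H : Subgroup G) (hNH : N ≤ H) (χ : ↥H → ℂ),
    IsIrrOver hNH θ χ →
    ∀ (β : ↥H → ℂ) (β' : ↥(corrSubgroup N N' τ H) → ℂ),
      IsChar ↥H β → IsChar ↥(corrSubgroup N N' τ H) β' →
      (∀ (h : ↥H) (h' : ↥(corrSubgroup N N' τ H)),
        τ ((h : G) : G ⧸ N) = ((h' : G') : G' ⧸ N') → β h = β' h') →
      σ H hNH (β * χ) = β' * σ H hNH χ

/-- A realization of a character triple isomorphic to `(G,N,θ)` with `N'` a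
central cyclic subgroup of order `n` and `θ'` a faithful linear character. -/
structure CentralTripleRealization (G : Type) [Group G]
    (N : Subgroup G) [N.Normal] (θ : ↥N → ℂ) (n : ℕ) where
  G' : Type
  [grp : Group G']
  [fin : Finite G']
  N' : Subgroup G'
  [norm : N'.Normal]
  θ' : ↥N' → ℂ
  central : N' ≤ Subgroup.center G'
  cyc : IsCyclic ↥N'
  card_eq : Nat.card ↥N' = n
  lin : ∃ l : ↥N' →* ℂˣ, (∀ x : ↥N', θ' x = (l x : ℂ)) ∧ Function.Injective l
  inv' : IsGInvariant N' θ'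
  irr' : IsIrrChar ↥N' θ'
  iso : CharTripleIso G N θ G' N' θ'


open scoped ComplexConjugate

namespace IsChar

variable {Γ Δ : Type} [Group Γ] [Group Δ]

lemma of_representation {V : Type} [AddCommGroup V] [Module ℂ V] [FiniteDimensional ℂ V]
    (ρ : Representation ℂ Γ V) : IsChar Γ ρ.character :=
  ⟨FDRep.of ρ, fun _ => rfl⟩

lemma of_matrix {ι : Type} [Fintype ι] [DecidableEq ι] (A : Γ →* Matrix ι ι ℂ) :
    IsChar Γ fun g => (A g).trace := by
  convert of_representation
    ((Matrix.toLinAlgEquiv' (R := ℂ) (n := ι)).toMonoidHom.comp A : Representation ℂ Γ (ι → ℂ))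
    using 2 with g
  exact (Matrix.trace_toLin'_eq (A g)).symm

lemma exists_matrix_s14 {χ : Γ → ℂ} (hχ : IsChar Γ χ) :
    ∃ (d : ℕ) (A : Γ →* Matrix (Fin d) (Fin d) ℂ), ∀ g, χ g = (A g).trace := by
  obtain ⟨V, hV⟩ := hχ
  let b := Module.finBasis ℂ V
  refine ⟨_, (LinearMap.toMatrixAlgEquiv b).toMonoidHom.comp V.ρ, fun g => ?_⟩
  rw [hV g, FDRep.character, LinearMap.trace_eq_matrix_trace ℂ b]
  rfl

lemma of_monoidHom (l : Γ →* ℂˣ) : IsChar Γ fun g => (l g : ℂ) := by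
  convert of_matrix ((Matrix.scalar (Fin 1)).toMonoidHom.comp ((Units.coeHom ℂ).comp l))
    using 2 with g
  simp [Matrix.trace]

lemma mul {χ ψ : Γ → ℂ} (hχ : IsChar Γ χ) (hψ : IsChar Γ ψ) : IsChar Γ (χ * ψ) := by
  obtain ⟨V, hV⟩ := hχ
  obtain ⟨W, hW⟩ := hψ
  convert of_representation (Representation.tprod V.ρ W.ρ)
  rw [Representation.char_tensor]
  ext g
  exact congrArg₂ (· * ·) (hV g) (hW g)

lemma comp {χ : Δ → ℂ} (hχ : IsChar Δ χ) (f : Γ →* Δ) : IsChar Γ fun g => χ (f g) := by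
  obtain ⟨d, A, hA⟩ := hχ.exists_matrix_s14
  simpa only [hA] using! of_matrix (A.comp f)

lemma eq_zero_of_apply_one_eq_zero {χ : Γ → ℂ} (hχ : IsChar Γ χ) (h : χ 1 = 0) : χ = 0 := by
  obtain ⟨d, A, hA⟩ := hχ.exists_matrix_s14
  obtain rfl : d = 0 := by simpa [hA] using h
  ext g
  simp [hA, Matrix.trace]

open Matrix ComplexOrder in
lemma apply_inv [Finite Γ] {χ : Γ → ℂ} (hχ : IsChar Γ χ) (g : Γ) : χ g⁻¹ = conj (χ g) := by
  obtain ⟨d, A, hA⟩ := hχ.exists_matrix_s14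
  have := Fintype.ofFinite Γ
  classical
  let S := ∑ h, (A h)ᴴ * A h
  have hS : S.PosDef := by
    have h1 : S = (A 1)ᴴ * A 1 + ∑ h ∈ Finset.univ.erase 1, (A h)ᴴ * A h :=
      (Finset.add_sum_erase _ _ (Finset.mem_univ 1)).symm
    rw [h1]
    refine Matrix.PosDef.add_posSemidef (by simpa using Matrix.PosDef.one) ?_
    exact Matrix.posSemidef_sum _ fun h _ => Matrix.posSemidef_conjTranspose_mul_self _
  have hinv : (A g)ᴴ * S * A g = S := by
    simp only [S, Finset.mul_sum, Finset.sum_mul]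
    refine Fintype.sum_equiv (Equiv.mulRight g) _ _ fun h => ?_
    simp [Matrix.mul_assoc]
  have hdet : IsUnit S.det := (Matrix.isUnit_iff_isUnit_det _).mp hS.isUnit
  have h2 : (A g)ᴴ * S = S * A g⁻¹ := by
    conv_rhs => rw [← hinv]
    rw [Matrix.mul_assoc _ (A g), ← map_mul]
    simp
  have h3 : (A g)ᴴ = S * A g⁻¹ * S⁻¹ := by
    rw [← h2, Matrix.mul_assoc, Matrix.mul_nonsing_inv _ hdet, Matrix.mul_one]
  rw [hA, hA, starRingEnd_apply, ← Matrix.trace_conjTranspose, h3, Matrix.trace_mul_comm,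
    ← Matrix.mul_assoc, Matrix.nonsing_inv_mul _ hdet, Matrix.one_mul]

lemma conjugate [Finite Γ] {χ : Γ → ℂ} (hχ : IsChar Γ χ) : IsChar Γ fun g => conj (χ g) := by
  simp only [← hχ.apply_inv]
  obtain ⟨V, hV⟩ := hχ
  exact ⟨FDRep.of (Representation.dual V.ρ), fun g => (hV g⁻¹).trans (V.char_dual g).symm⟩

lemma exists_charInner_self_eq_natCast [Finite Γ] {χ : Γ → ℂ} (hχ : IsChar Γ χ) :
    ∃ k : ℕ, charInner Γ χ χ = k := by
  obtain ⟨V, hV⟩ := hχ.mul hχ.conjugate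
  have := Fintype.ofFinite Γ
  have : Invertible (Nat.card Γ : ℂ) := invertibleOfNonzero (by simp)
  refine ⟨_, (?_ : _ = _).trans V.average_char_eq_finrank_invariants⟩
  rw [charInner, finsum_eq_sum_of_fintype]
  simp only [← hV, Pi.mul_apply]

/-- A character of degree one with nonnegative real values is trivial. -/
lemma eq_one [Finite Γ] {χ : Γ → ℂ} (hχ : IsChar Γ χ) (h1 : χ 1 = 1)
    (h0 : ∀ g, ∃ r : ℝ, 0 ≤ r ∧ χ g = r) (g : Γ) : χ g = 1 := by
  obtain ⟨d, A, hA⟩ := hχ.exists_matrix_s14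
  obtain rfl : d = 1 := by
    have := hA 1
    simp only [h1, map_one, Matrix.trace_one, Fintype.card_fin] at this
    exact_mod_cast this.symm
  have hpow : ∀ n : ℕ, χ g ^ n = χ (g ^ n) := by
    intro n
    induction n with
    | zero => simp [h1]
    | succ n ih =>
      rw [pow_succ, ih, pow_succ]
      simp [hA, Matrix.trace, Matrix.mul_apply]
  obtain ⟨r, hr, hgr⟩ := h0 g
  have hroot := hpow (Nat.card Γ)
  rw [pow_card_eq_one', h1, hgr] at hroot
  have : r ^ Nat.card Γ = 1 := by exact_mod_cast hroot
  rw [hgr, (pow_eq_one_iff_of_nonneg hr Nat.card_pos.ne').mp this, Complex.ofReal_one]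

end IsChar

section CharInner

variable {Γ : Type} [Group Γ]

lemma charInner_self_eq_ofReal [Fintype Γ] (φ : Γ → ℂ) :
    charInner Γ φ φ = ((Nat.card Γ : ℝ)⁻¹ * ∑ g, ‖φ g‖ ^ 2 : ℝ) := by
  rw [charInner, finsum_eq_sum_of_fintype]
  push_cast
  simp only [Complex.mul_conj']

variable [Finite Γ]

lemma charInner_self_nonneg (φ : Γ → ℂ) : 0 ≤ (charInner Γ φ φ).re := by
  have := Fintype.ofFinite Γ
  rw [charInner_self_eq_ofReal, Complex.ofReal_re]
  positivity

lemma eq_zero_of_charInner_self_eq_zero {φ : Γ → ℂ} (h : charInner Γ φ φ = 0) : φ = 0 := by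
  have := Fintype.ofFinite Γ
  rw [charInner_self_eq_ofReal, Complex.ofReal_eq_zero,
    mul_eq_zero_iff_left (inv_ne_zero (by simp)),
    Finset.sum_eq_zero_iff_of_nonneg fun _ _ => by positivity] at h
  ext g
  simpa using h g (Finset.mem_univ g)

lemma charInner_conj (φ ψ : Γ → ℂ) : conj (charInner Γ φ ψ) = charInner Γ ψ φ := by
  have := Fintype.ofFinite Γ
  simp only [charInner, finsum_eq_sum_of_fintype, map_mul, map_sum, map_inv₀, map_natCast,
    Complex.conj_conj, mul_comm]

lemma charInner_sub_self (φ ψ : Γ → ℂ) : charInner Γ (φ - ψ) (φ - ψ) =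
    charInner Γ φ φ - charInner Γ φ ψ - charInner Γ ψ φ + charInner Γ ψ ψ := by
  have := Fintype.ofFinite Γ
  simp only [charInner, finsum_eq_sum_of_fintype, ← mul_sub, ← mul_add, ← Finset.sum_sub_distrib,
    ← Finset.sum_add_distrib]
  congr 1
  refine Finset.sum_congr rfl fun g _ => ?_
  simp only [Pi.sub_apply, map_sub]
  ring

/-- Equality in the Cauchy–Schwarz inequality, for a vector `φ` of norm one. -/
lemma eq_of_charInner_eq_natCast {φ ψ : Γ → ℂ} {k : ℕ} (hk : k ≠ 0)
    (hφ : charInner Γ φ φ = 1) (hφψ : charInner Γ φ ψ = k) (hψ : charInner Γ ψ ψ = k) :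
    φ = ψ := by
  have hψφ : charInner Γ ψ φ = k := by rw [← charInner_conj, hφψ, map_natCast]
  have h := charInner_sub_self φ ψ
  rw [hφ, hφψ, hψφ, hψ] at h
  have h0 := charInner_self_nonneg (φ - ψ)
  have hk1 : (k : ℝ) ≤ 1 := by
    rw [h] at h0
    simpa using h0
  obtain rfl : k = 1 := le_antisymm (by exact_mod_cast hk1) (Nat.one_le_iff_ne_zero.mpr hk)
  exact sub_eq_zero.mp (eq_zero_of_charInner_self_eq_zero (by rw [h]; norm_num))

end CharInner

lemma IsIrrChar.apply_one_ne_zero {Γ : Type} [Group Γ] {χ : Γ → ℂ} (hχ : IsIrrChar Γ χ) :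
    χ 1 ≠ 0 := by
  intro h
  have := hχ.2
  simp [hχ.1.eq_zero_of_apply_one_eq_zero h, charInner] at this

section FiberAverage

variable {Γ Δ : Type} [Group Γ] [Group Δ]

/-- The average of `α` over the fibres of a homomorphism `f`. -/
def fiberAverage (f : Γ →* Δ) (α : Γ → ℂ) (δ : Δ) : ℂ :=
  (Nat.card f.ker : ℂ)⁻¹ * ∑ᶠ γ : {γ // f γ = δ}, α γ

lemma fiberAverage_apply_map (f : Γ →* Δ) (α : Γ → ℂ) (γ : Γ) :
    fiberAverage f α (f γ) = (Nat.card f.ker : ℂ)⁻¹ * ∑ᶠ k : f.ker, α (γ * k) := by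
  let e : f.ker ≃ {x // f x = f γ} :=
    { toFun := fun k => ⟨γ * k, by rw [map_mul, f.mem_ker.mp k.2, mul_one]⟩
      invFun := fun x => ⟨γ⁻¹ * x, by rw [f.mem_ker, map_mul, x.2, map_inv, inv_mul_cancel]⟩
      left_inv := fun k => by simp
      right_inv := fun x => by simp }
  rw [fiberAverage, ← finsum_comp_equiv e]
  rfl

/-- The average over the kernel, computed on a parametrization of the kernel. -/
lemma fiberAverage_apply_one (f : Γ →* Δ) (α : Γ → ℂ) {K : Type} (i : K → Γ)
    (hi : Function.Injective i) (hrange : ∀ γ, f γ = 1 ↔ γ ∈ Set.range i) :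
    fiberAverage f α 1 = (Nat.card K : ℂ)⁻¹ * ∑ᶠ k, α (i k) := by
  let e : K ≃ {γ // f γ = 1} :=
    (Equiv.ofInjective i hi).trans (Equiv.subtypeEquivRight fun γ => (hrange γ).symm)
  rw [fiberAverage, ← finsum_comp_equiv e, Nat.card_congr (α := f.ker) e.symm]
  rfl

variable [Finite Γ]

lemma fiberAverage_mul_comp (f : Γ →* Δ) (α : Γ → ℂ) (β : Δ → ℂ) :
    fiberAverage f (fun γ => α γ * β (f γ)) = fiberAverage f α * β := by
  ext δ
  rw [Pi.mul_apply, fiberAverage, fiberAverage, mul_assoc, finsum_mul' _ _ (Set.toFinite _)]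
  congr 2
  ext γ
  rw [γ.2]

lemma fiberAverage_one {f : Γ →* Δ} (hf : Function.Surjective f) :
    fiberAverage f (fun _ => 1) = fun _ => 1 := by
  ext δ
  obtain ⟨γ, rfl⟩ := hf δ
  have := Fintype.ofFinite f.ker
  rw [fiberAverage_apply_map, finsum_eq_sum_of_fintype, Finset.sum_const, Finset.card_univ,
    Fintype.card_eq_nat_card, nsmul_one, inv_mul_cancel₀]
  exact_mod_cast Nat.card_pos.ne'

lemma fiberAverage_comp {f : Γ →* Δ} (hf : Function.Surjective f) (β : Δ → ℂ) :
    fiberAverage f (fun γ => β (f γ)) = β := by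
  have := fiberAverage_mul_comp f (fun _ => 1) β
  rw [fiberAverage_one hf] at this
  simp only [one_mul] at this
  rw [this]
  ext
  simp

/-- Averaging over the fibres is adjoint to inflation. -/
lemma charInner_fiberAverage {f : Γ →* Δ} (hf : Function.Surjective f) (α : Γ → ℂ) (β : Δ → ℂ) :
    charInner Γ α (fun γ => β (f γ)) = charInner Δ (fiberAverage f α) β := by
  have := Finite.of_surjective f hf
  have := Fintype.ofFinite Γ
  have := Fintype.ofFinite Δ
  classical
  have hcard : Nat.card Γ = Nat.card f.ker * Nat.card Δ := by
    rw [Subgroup.card_eq_card_quotient_mul_card_subgroup f.ker, mul_comm,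
      Nat.card_congr (QuotientGroup.quotientKerEquivOfSurjective f hf).toEquiv]
  have h : ∀ δ, fiberAverage f α δ * conj (β δ) =
      fiberAverage f (fun γ => α γ * conj (β (f γ))) δ := fun δ =>
    (congrFun (fiberAverage_mul_comp f α fun δ => conj (β δ)) δ).symm
  simp only [charInner, finsum_eq_sum_of_fintype, hcard, h]
  simp only [fiberAverage, finsum_eq_sum_of_fintype, ← Finset.mul_sum]
  rw [Fintype.sum_fiberwise f fun γ => α γ * conj (β (f γ))]
  push_cast
  rw [mul_inv]
  ring

lemma charInner_comp {f : Γ →* Δ} (hf : Function.Surjective f) (α β : Δ → ℂ) :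
    charInner Γ (fun γ => α (f γ)) (fun γ => β (f γ)) = charInner Δ α β := by
  rw [charInner_fiberAverage hf, fiberAverage_comp hf]

/-- The average over the fibres is the character afforded by the invariants of the kernel. -/
lemma IsChar.fiberAverage {f : Γ →* Δ} (hf : Function.Surjective f) {χ : Γ → ℂ}
    (hχ : IsChar Γ χ) : IsChar Δ (fiberAverage f χ) := by
  obtain ⟨V, hV⟩ := hχ
  let ρ : Representation ℂ Γ V := V.ρ
  let K := f.ker
  have := Fintype.ofFinite K
  have : Invertible (Fintype.card K : ℂ) := invertibleOfNonzero (by simp)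
  let P := Representation.averageMap (ρ.comp K.subtype)
  let W := Representation.invariants (ρ.comp K.subtype)
  have hP : LinearMap.IsProj W P := Representation.isProj_averageMap _
  convert IsChar.of_representation ((ρ.quotientToInvariants K).comp
    (QuotientGroup.quotientKerEquivOfSurjective f hf).symm.toMonoidHom)
  ext δ
  obtain ⟨γ, rfl⟩ := hf δ
  have hγ : (QuotientGroup.quotientKerEquivOfSurjective f hf).symm (f γ) = (γ : Γ ⧸ K) :=
    (MulEquiv.symm_apply_eq _).mpr rfl
  have htr : LinearMap.trace ℂ V (ρ γ * P) = LinearMap.trace ℂ W (ρ.toInvariants K γ) := by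
    have h1 : ρ γ * P = W.subtype ∘ₗ (ρ.toInvariants K γ ∘ₗ hP.codRestrict) := by
      ext v
      rfl
    rw [h1, LinearMap.trace_comp_comm', LinearMap.comp_assoc]
    congr 1
    ext w
    simp
  have hsum : (Nat.card K : ℂ)⁻¹ * ∑ k : K, χ (γ * k) = LinearMap.trace ℂ V (ρ γ * P) := by
    simp [P, Representation.averageMap, GroupAlgebra.average, map_sum, hV, FDRep.character,
      Finset.mul_sum, ρ]
  rw [fiberAverage_apply_map, finsum_eq_sum_of_fintype, hsum, htr]
  change _ = LinearMap.trace ℂ W (ρ.quotientToInvariants K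
    ((QuotientGroup.quotientKerEquivOfSurjective f hf).symm (f γ)))
  rw [hγ]
  rfl

end FiberAverage

section Twist

variable {Γ H H' : Type} [Group Γ] [Group H] [Group H']

/-- Inflate `χ` along `p`, multiply by the conjugate of `x` and deflate along `q`. -/
def twist (p : Γ →* H) (q : Γ →* H') (x : Γ → ℂ) (χ : H → ℂ) : H' → ℂ :=
  fiberAverage q fun γ => χ (p γ) * conj (x γ)

/-- `x` is a character of `Γ` whose restriction to the kernel of `q` is irreducible. -/
structure IsTwisting (q : Γ →* H') (x : Γ → ℂ) : Prop where
  isChar : IsChar Γ x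
  average_one : fiberAverage q (fun γ => x γ * conj (x γ)) 1 = 1

variable [Finite Γ] {p : Γ →* H} {q : Γ →* H'} {x : Γ → ℂ}

lemma IsTwisting.average (hx : IsTwisting q x) (hq : Function.Surjective q) :
    fiberAverage q (fun γ => x γ * conj (x γ)) = fun _ => 1 := by
  have := Finite.of_surjective q hq
  ext h'
  refine ((hx.isChar.mul hx.isChar.conjugate).fiberAverage hq).eq_one hx.average_one
    (fun h' => ?_) h'
  have := Fintype.ofFinite Γ
  classical
  refine ⟨(Nat.card q.ker : ℝ)⁻¹ * ∑ γ : {γ // q γ = h'}, ‖x γ‖ ^ 2, by positivity, ?_⟩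
  rw [fiberAverage, finsum_eq_sum_of_fintype]
  push_cast
  simp only [Pi.mul_apply, Complex.mul_conj']

lemma IsTwisting.charInner_mul (hx : IsTwisting q x) (hq : Function.Surjective q)
    (α β : H' → ℂ) :
    charInner Γ (fun γ => x γ * α (q γ)) (fun γ => x γ * β (q γ)) = charInner H' α β := by
  calc
    _ = charInner Γ (fun γ => x γ * conj (x γ) * α (q γ)) fun γ => β (q γ) := by
      simp only [charInner, map_mul]
      congr 2
      ext γ
      ring
    _ = _ := by
      rw [charInner_fiberAverage hq, fiberAverage_mul_comp, hx.average hq]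
      congr 1
      ext
      simp

/-- If characters of `H` and `H'` correspond to each other, so do their inner products. -/
lemma IsTwisting.charInner_eq (hx : IsTwisting q x) (hp : Function.Surjective p)
    (hq : Function.Surjective q) {α β : H → ℂ} {α' β' : H' → ℂ}
    (hα : ∀ γ, α (p γ) = x γ * α' (q γ)) (hβ : ∀ γ, β (p γ) = x γ * β' (q γ)) :
    charInner H α β = charInner H' α' β' := by
  rw [← hx.charInner_mul hq, ← charInner_comp hp]
  simp only [hα, hβ]

lemma charInner_mul_comp (hq : Function.Surjective q) (χ : H → ℂ) (ψ : H' → ℂ) :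
    charInner Γ (fun γ => χ (p γ)) (fun γ => x γ * ψ (q γ)) = charInner H' (twist p q x χ) ψ := by
  rw [twist, ← charInner_fiberAverage hq]
  simp only [charInner, map_mul, mul_assoc]

lemma isChar_twist (hx : IsChar Γ x) (hq : Function.Surjective q) {χ : H → ℂ}
    (hχ : IsChar H χ) : IsChar H' (twist p q x χ) :=
  ((hχ.comp p).mul hx.conjugate).fiberAverage hq

lemma IsTwisting.apply_eq_mul_twist (hx : IsTwisting q x) (hp : Function.Surjective p)
    (hq : Function.Surjective q) {χ : H → ℂ} (hχ : IsIrrChar H χ) (h1 : twist p q x χ 1 ≠ 0)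
    (γ : Γ) : χ (p γ) = x γ * twist p q x χ (q γ) := by
  have := Finite.of_surjective q hq
  obtain ⟨k, hk⟩ := (isChar_twist (p := p) hx.isChar hq hχ.1).exists_charInner_self_eq_natCast
  suffices h : (fun γ => χ (p γ)) = fun γ => x γ * twist p q x χ (q γ) from congrFun h γ
  refine eq_of_charInner_eq_natCast (k := k) ?_ ?_ ?_ ?_
  · rintro rfl
    rw [Nat.cast_zero] at hk
    exact h1 (congrFun (eq_zero_of_charInner_self_eq_zero hk) 1)
  · rw [charInner_comp hp, hχ.2]
  · rw [charInner_mul_comp hq, hk]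
  · rw [hx.charInner_mul hq, hk]

lemma IsTwisting.apply_untwist_eq_mul (hx : IsTwisting q x) (hp : Function.Surjective p)
    (hq : Function.Surjective q) {ψ : H' → ℂ} (hψ : IsIrrChar H' ψ)
    (h1 : twist q p (fun γ => conj (x γ)) ψ 1 ≠ 0) (γ : Γ) :
    twist q p (fun γ => conj (x γ)) ψ (p γ) = x γ * ψ (q γ) := by
  have := Finite.of_surjective p hp
  obtain ⟨k, hk⟩ :=
    (isChar_twist (p := q) hx.isChar.conjugate hp hψ.1).exists_charInner_self_eq_natCast
  suffices h : (fun γ => x γ * ψ (q γ)) = fun γ => twist q p (fun γ => conj (x γ)) ψ (p γ) from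
    (congrFun h γ).symm
  refine eq_of_charInner_eq_natCast (k := k) ?_ ?_ ?_ ?_
  · rintro rfl
    rw [Nat.cast_zero] at hk
    exact h1 (congrFun (eq_zero_of_charInner_self_eq_zero hk) 1)
  · rw [hx.charInner_mul hq, hψ.2]
  · rw [charInner_fiberAverage hp, ← hk, twist]
    simp only [Complex.conj_conj, mul_comm]
  · rw [charInner_comp hp, hk]

lemma IsTwisting.twist_eq (hx : IsTwisting q x) (hq : Function.Surjective q) {χ : H → ℂ}
    {ψ : H' → ℂ} (h : ∀ γ, χ (p γ) = x γ * ψ (q γ)) : twist p q x χ = ψ := by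
  have : (fun γ => χ (p γ) * conj (x γ)) = fun γ => x γ * conj (x γ) * ψ (q γ) := by
    ext γ
    rw [h]
    ring
  rw [twist, this, fiberAverage_mul_comp, hx.average hq]
  ext
  simp

lemma untwist_eq (hp : Function.Surjective p) {χ : H → ℂ} {ψ : H' → ℂ}
    (h : ∀ γ, χ (p γ) = x γ * ψ (q γ)) : twist q p (fun γ => conj (x γ)) ψ = χ := by
  rw [twist, ← fiberAverage_comp hp χ]
  simp only [h, Complex.conj_conj, mul_comm]

/-- Twisting by `x` is a bijection between the irreducible characters of `H` and `H'` with
nonzero twist. -/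
theorem IsTwisting.bijOn (hx : IsTwisting q x) (hp : Function.Surjective p)
    (hq : Function.Surjective q) :
    Set.BijOn (twist p q x) {χ | IsIrrChar H χ ∧ twist p q x χ 1 ≠ 0}
      {ψ | IsIrrChar H' ψ ∧ twist q p (fun γ => conj (x γ)) ψ 1 ≠ 0} := by
  refine Set.InvOn.bijOn (f' := twist q p fun γ => conj (x γ)) ⟨?_, ?_⟩ ?_ ?_
  · exact fun χ hχ => untwist_eq hp (hx.apply_eq_mul_twist hp hq hχ.1 hχ.2)
  · exact fun ψ hψ => hx.twist_eq hq (hx.apply_untwist_eq_mul hp hq hψ.1 hψ.2)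
  · intro χ hχ
    have h := hx.apply_eq_mul_twist hp hq hχ.1 hχ.2
    refine ⟨⟨isChar_twist hx.isChar hq hχ.1.1, ?_⟩, ?_⟩
    · rw [← hx.charInner_eq hp hq h h, hχ.1.2]
    · rw [untwist_eq hp h]
      exact hχ.1.apply_one_ne_zero
  · intro ψ hψ
    have h := hx.apply_untwist_eq_mul hp hq hψ.1 hψ.2
    refine ⟨⟨isChar_twist hx.isChar.conjugate hp hψ.1.1, ?_⟩, ?_⟩
    · rw [hx.charInner_eq hp hq h h, hψ.1.2]
    · rw [hx.twist_eq hq h]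
      exact hψ.1.apply_one_ne_zero

lemma twist_mul {χ β : H → ℂ} {β' : H' → ℂ} (h : ∀ γ, β (p γ) = β' (q γ)) :
    twist p q x (β * χ) = β' * twist p q x χ := by
  rw [mul_comm β', twist, twist, ← fiberAverage_mul_comp]
  congr 1
  ext γ
  rw [Pi.mul_apply, h]
  ring

end Twist

section FiberProduct

variable {G G' : Type} [Group G] [Group G'] {N : Subgroup G} [N.Normal]

/-- The pairs in `H × H'` whose components have the same image in `G ⧸ N`. -/
def fiberProduct (N : Subgroup G) [N.Normal] (π : G' →* G ⧸ N) (H : Subgroup G)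
    (H' : Subgroup G') : Subgroup (H × H') :=
  ((QuotientGroup.mk' N).comp (H.subtype.comp (MonoidHom.fst H H'))).eqLocus
    (π.comp (H'.subtype.comp (MonoidHom.snd H H')))

namespace fiberProduct

variable (π : G' →* G ⧸ N) (H : Subgroup G) (H' : Subgroup G')

/-- The first projection. -/
def fst : fiberProduct N π H H' →* H := (MonoidHom.fst H H').comp (Subgroup.subtype _)

/-- The second projection. -/
def snd : fiberProduct N π H H' →* H' := (MonoidHom.snd H H').comp (Subgroup.subtype _)

variable {π H H'}

lemma mk_fst (γ : fiberProduct N π H H') : ((fst π H H' γ : G) : G ⧸ N) = π (snd π H H' γ) := γ.2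

end fiberProduct

lemma mem_corrSubgroup_ker_iff {π : G' →* G ⧸ N} (hπ : Function.Surjective π) {H : Subgroup G}
    {u : G'} : u ∈ corrSubgroup N π.ker (QuotientGroup.quotientKerEquivOfSurjective π hπ).symm H ↔
      ∃ h ∈ H, (h : G ⧸ N) = π u := by
  simp only [corrSubgroup, Subgroup.mem_comap, Subgroup.mem_map, exists_exists_and_eq_and]
  refine exists_congr fun h => and_congr_right fun _ => ?_
  exact (QuotientGroup.quotientKerEquivOfSurjective π hπ).symm_apply_eq

variable {θ : N → ℂ} (P : ProjRepOfTriple G N θ) {π : G' →* G ⧸ N} {s : G' → ℂˣ}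

/-- The function on the fiber product whose values are the traces of the matrices `s u • X g`. -/
def ProjRepOfTriple.twisting (π : G' →* G ⧸ N) (s : G' → ℂˣ) (H : Subgroup G) (H' : Subgroup G')
    (γ : fiberProduct N π H H') : ℂ :=
  (s (fiberProduct.snd π H H' γ) : ℂ) * (P.X (fiberProduct.fst π H H' γ)).trace

lemma ProjRepOfTriple.isChar_twisting (hs1 : s 1 = 1)
    (hs : ∀ u v, s (u * v) = s u * s v * P.a (π u) (π v)) (H : Subgroup G) (H' : Subgroup G') :
    IsChar _ (P.twisting π s H H') := by
  let A : fiberProduct N π H H' →* Matrix (Fin P.d) (Fin P.d) ℂ :=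
    { toFun := fun γ => (s (fiberProduct.snd π H H' γ) : ℂ) • P.X (fiberProduct.fst π H H' γ)
      map_one' := by simp [hs1, P.map_one]
      map_mul' := fun γ δ => by
        rw [map_mul, map_mul, Subgroup.coe_mul, Subgroup.coe_mul, hs, smul_mul_smul_comm,
          P.factor, fiberProduct.mk_fst, fiberProduct.mk_fst, smul_smul]
        push_cast
        rfl }
  convert IsChar.of_matrix A using 2 with γ
  exact (Matrix.trace_smul (s (fiberProduct.snd π H H' γ) : ℂ) (P.X _)).symm

section Over

variable {H : Subgroup G} {H' : Subgroup G'}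

lemma fiberAverage_snd_one (hNH : N ≤ H) (α : fiberProduct N π H H' → ℂ) :
    fiberAverage (fiberProduct.snd π H H') α 1 = (Nat.card N : ℂ)⁻¹ * ∑ᶠ n : N,
      α ⟨(Subgroup.inclusion hNH n, 1), by
        change ((n : G) : G ⧸ N) = π 1
        rw [map_one, QuotientGroup.eq_one_iff]
        exact n.2⟩ := by
  refine fiberAverage_apply_one _ _ _ (fun m n h => ?_) fun γ => ⟨fun h => ?_, ?_⟩
  · exact Subtype.ext (congrArg (fun γ : fiberProduct N π H H' => (γ.1.1 : G)) h)
  · have h1 := fiberProduct.mk_fst γ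
    rw [h, Subgroup.coe_one, map_one, QuotientGroup.eq_one_iff] at h1
    exact ⟨⟨_, h1⟩, Subtype.ext (Prod.ext rfl h.symm)⟩
  · rintro ⟨n, rfl⟩
    rfl

lemma fiberAverage_fst_one (hH' : π.ker ≤ H') (α : fiberProduct N π H H' → ℂ) :
    fiberAverage (fiberProduct.fst π H H') α 1 = (Nat.card π.ker : ℂ)⁻¹ * ∑ᶠ z : π.ker,
      α ⟨(1, Subgroup.inclusion hH' z), by
        change ((1 : G) : G ⧸ N) = π z
        rw [π.mem_ker.mp z.2, QuotientGroup.mk_one]⟩ := by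
  refine fiberAverage_apply_one _ _ _ (fun y z h => ?_) fun γ => ⟨fun h => ?_, ?_⟩
  · exact Subtype.ext (congrArg (fun γ : fiberProduct N π H H' => (γ.1.2 : G')) h)
  · have h1 := fiberProduct.mk_fst γ
    rw [h, Subgroup.coe_one, QuotientGroup.mk_one] at h1
    exact ⟨⟨_, π.mem_ker.mpr h1.symm⟩, Subtype.ext (Prod.ext h.symm rfl)⟩
  · rintro ⟨z, rfl⟩
    rfl

lemma ProjRepOfTriple.twist_one (hs1 : s 1 = 1) (hNH : N ≤ H) (χ : H → ℂ) :
    twist (fiberProduct.fst π H H') (fiberProduct.snd π H H') (P.twisting π s H H') χ 1 =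
      charInner N (fun n => χ (Subgroup.inclusion hNH n)) θ := by
  rw [twist, fiberAverage_snd_one hNH, charInner]
  congr 2
  ext n
  simp [twisting, fiberProduct.fst, fiberProduct.snd, hs1, P.traceN]

lemma ProjRepOfTriple.untwist_one [Finite G'] {θ' : π.ker → ℂ} (hθ' : ∀ z, conj (θ' z) = s z)
    (hH' : π.ker ≤ H') (ψ : H' → ℂ) :
    twist (fiberProduct.snd π H H') (fiberProduct.fst π H H')
        (fun γ => conj (P.twisting π s H H' γ)) ψ 1 =
      charInner π.ker (fun z => ψ (Subgroup.inclusion hH' z)) θ' * θ 1 := by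
  rw [twist, fiberAverage_fst_one hH', charInner, mul_assoc, finsum_mul' _ _ (Set.toFinite _)]
  congr 2
  ext z
  have h1 := P.traceN 1
  rw [Subgroup.coe_one] at h1
  simp [twisting, fiberProduct.fst, fiberProduct.snd, hθ', h1, mul_assoc]

lemma ProjRepOfTriple.isTwisting (hθ : IsIrrChar N θ) (hs1 : s 1 = 1)
    (hs : ∀ u v, s (u * v) = s u * s v * P.a (π u) (π v)) (hNH : N ≤ H) :
    IsTwisting (fiberProduct.snd π H H') (P.twisting π s H H') where
  isChar := P.isChar_twisting hs1 hs H H'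
  average_one := by
    rw [fiberAverage_snd_one hNH, ← hθ.2, charInner]
    congr 2
    ext n
    simp [twisting, fiberProduct.fst, fiberProduct.snd, hs1, P.traceN]

end Over

section Iso

/-- The subgroup of `G'` corresponding to `H`. -/
abbrev corrOfSurjective (hπ : Function.Surjective π) (H : Subgroup G) : Subgroup G' :=
  corrSubgroup N π.ker (QuotientGroup.quotientKerEquivOfSurjective π hπ).symm H

variable (hπ : Function.Surjective π) (H : Subgroup G)

lemma fiberProduct.fst_surjective :
    Function.Surjective (fiberProduct.fst π H (corrOfSurjective hπ H)) := by
  intro h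
  obtain ⟨u, hu⟩ := hπ (h : G)
  exact ⟨⟨(h, ⟨u, (mem_corrSubgroup_ker_iff hπ).mpr ⟨h, h.2, hu.symm⟩⟩), hu.symm⟩, rfl⟩

lemma fiberProduct.snd_surjective :
    Function.Surjective (fiberProduct.snd π H (corrOfSurjective hπ H)) := by
  intro u
  obtain ⟨h, hh, hu⟩ := (mem_corrSubgroup_ker_iff hπ).mp u.2
  exact ⟨⟨(⟨h, hh⟩, u), hu⟩, rfl⟩

/-- A scalar-valued function `s` on `G'` whose failure to be multiplicative is measured by the
factor set of `P` makes `G'` the ambient group of a character triple isomorphic to `(G, N, θ)`. -/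
def ProjRepOfTriple.charTripleIso [Finite G] [Finite G'] (hθ : IsIrrChar N θ) (hs1 : s 1 = 1)
    (hs : ∀ u v, s (u * v) = s u * s v * P.a (π u) (π v)) {θ' : π.ker → ℂ}
    (hθ' : ∀ z, conj (θ' z) = s z) : CharTripleIso G N θ G' π.ker θ' where
  τ := (QuotientGroup.quotientKerEquivOfSurjective π hπ).symm
  σ H _ := twist (fiberProduct.fst π H (corrOfSurjective hπ H))
    (fiberProduct.snd π H (corrOfSurjective hπ H))
    (P.twisting π s H (corrOfSurjective hπ H))
  bij H hNH := by
    have h := (P.isTwisting hθ hs1 hs hNH).bijOn (fiberProduct.fst_surjective hπ H)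
      (fiberProduct.snd_surjective hπ H)
    simp only [P.twist_one hs1 hNH, P.untwist_one hθ' (le_corrSubgroup _ _ _ H), ne_eq,
      mul_eq_zero, hθ.apply_one_ne_zero, or_false] at h
    exact h
  inner_res H hNH K hNK hKH χ ψ hχ hψ := by
    refine (P.isTwisting hθ hs1 hs hNK).charInner_eq (fiberProduct.fst_surjective hπ K)
      (fiberProduct.snd_surjective hπ K) (fun γ => ?_) ?_
    · exact (P.isTwisting hθ hs1 hs hNH).apply_eq_mul_twist (fiberProduct.fst_surjective hπ H)
        (fiberProduct.snd_surjective hπ H) hχ.1 (by rw [P.twist_one hs1 hNH]; exact hχ.2)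
        ⟨(Subgroup.inclusion hKH γ.1.1, Subgroup.inclusion (corrSubgroup_mono _ _ _ hKH) γ.1.2),
          γ.2⟩
    · exact (P.isTwisting hθ hs1 hs hNK).apply_eq_mul_twist (fiberProduct.fst_surjective hπ K)
        (fiberProduct.snd_surjective hπ K) hψ.1 (by rw [P.twist_one hs1 hNK]; exact hψ.2)
  mul_compat H hNH χ _ β β' _ _ h := twist_mul fun γ =>
    h _ _ ((QuotientGroup.quotientKerEquivOfSurjective π hπ).symm_apply_eq.mpr γ.2)

end Iso

end FiberProduct

section CocycleExtension

variable {Q : Type} [Group Q] {a : Q → Q → ℂˣ}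

namespace IsTwoCocycle

lemma one_left (ha : IsTwoCocycle a) (x : Q) : a 1 x = a 1 1 := by
  simpa using (ha 1 1 x).symm

lemma one_right (ha : IsTwoCocycle a) (x : Q) : a x 1 = a 1 1 := by
  simpa using ha x 1 1

lemma isTwoCoboundary_pow_card [Finite Q] (ha : IsTwoCocycle a) :
    IsTwoCoboundary fun x y => a x y ^ Nat.card Q := by
  have := Fintype.ofFinite Q
  refine ⟨fun x => ∏ z, a x z, fun x y => ?_⟩
  have h : ∏ z, a x y * a (x * y) z = ∏ z, a y z * a x (y * z) :=
    Finset.prod_congr rfl fun z _ => ha x y z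
  rw [Finset.prod_mul_distrib, Finset.prod_mul_distrib, Finset.prod_const, Finset.card_univ,
    Fintype.card_eq_nat_card,
    Fintype.prod_equiv (Equiv.mulLeft y) (fun z => a x (y * z)) (fun z => a x z) fun _ => rfl] at h
  rw [eq_mul_inv_iff_mul_eq]
  exact h.trans (mul_comm _ _)

lemma cocycleClassOrder_spec [Finite Q] (ha : IsTwoCocycle a) :
    0 < cocycleClassOrder a ∧ IsTwoCoboundary fun x y => a x y ^ cocycleClassOrder a :=
  Nat.sInf_mem (s := {m | 0 < m ∧ IsTwoCoboundary fun x y => a x y ^ m})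
    ⟨Nat.card Q, Nat.card_pos, ha.isTwoCoboundary_pow_card⟩

end IsTwoCocycle

/-- The central extension of `Q` by `ℂˣ` with cocycle `a`. -/
@[ext]
structure CocycleExtension (ha : IsTwoCocycle a) where
  base : Q
  scalar : ℂˣ

namespace CocycleExtension

variable {ha : IsTwoCocycle a}

instance : Mul (CocycleExtension ha) :=
  ⟨fun u v => ⟨u.base * v.base, u.scalar * v.scalar * a u.base v.base⟩⟩

instance : One (CocycleExtension ha) := ⟨⟨1, (a 1 1)⁻¹⟩⟩

instance : Inv (CocycleExtension ha) :=
  ⟨fun u => ⟨u.base⁻¹, (u.scalar * a u.base⁻¹ u.base * a 1 1)⁻¹⟩⟩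

@[simp] lemma base_mul (u v : CocycleExtension ha) : (u * v).base = u.base * v.base := rfl

@[simp] lemma scalar_mul (u v : CocycleExtension ha) :
    (u * v).scalar = u.scalar * v.scalar * a u.base v.base := rfl

@[simp] lemma base_one : (1 : CocycleExtension ha).base = 1 := rfl

@[simp] lemma scalar_one : (1 : CocycleExtension ha).scalar = (a 1 1)⁻¹ := rfl

@[simp] lemma base_inv (u : CocycleExtension ha) : u⁻¹.base = u.base⁻¹ := rfl

@[simp] lemma scalar_inv (u : CocycleExtension ha) :
    u⁻¹.scalar = (u.scalar * a u.base⁻¹ u.base * a 1 1)⁻¹ := rfl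

instance : Group (CocycleExtension ha) :=
  Group.ofLeftAxioms
    (fun u v w => by
      ext1
      · exact mul_assoc _ _ _
      · have h := ha u.base v.base w.base
        simp only [scalar_mul, base_mul]
        calc
          _ = u.scalar * v.scalar * w.scalar *
              (a u.base v.base * a (u.base * v.base) w.base) := by ac_rfl
          _ = _ := by rw [h]; ac_rfl)
    (fun u => by
      ext1
      · exact one_mul _
      · simp [ha.one_left])
    (fun u => by
      ext1
      · exact inv_mul_cancel _
      · simp only [scalar_mul, scalar_inv, base_inv, scalar_one]
        rw [mul_inv_rev, mul_assoc, inv_mul_cancel_right])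

/-- The projection onto the base. -/
def proj (ha : IsTwoCocycle a) : CocycleExtension ha →* Q where
  toFun := base
  map_one' := rfl
  map_mul' _ _ := rfl

/-- The subgroup cut out by a trivialization `ν` of the `n`-th power of the cocycle: it is a
central extension of `Q` by the group of `n`-th roots of unity. -/
def rootSubgroup (ha : IsTwoCocycle a) {n : ℕ} {ν : Q → ℂˣ}
    (hν : ∀ x y, a x y ^ n = ν x * ν y * (ν (x * y))⁻¹) : Subgroup (CocycleExtension ha) where
  carrier := {u | u.scalar ^ n * ν u.base = 1}
  one_mem' := by
    have h := hν 1 1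
    rw [mul_one, mul_inv_cancel_right] at h
    simp [h]
  mul_mem' := by
    intro u v hu hv
    simp only [Set.mem_ofPred_eq, scalar_mul, base_mul, mul_pow, hν] at hu hv ⊢
    rw [mul_assoc, inv_mul_cancel_right, mul_mul_mul_comm, hu, hv, one_mul]
  inv_mem' := by
    intro u hu
    have h1 := hν 1 1
    have h := hν u.base⁻¹ u.base
    rw [mul_one, mul_inv_cancel_right] at h1
    rw [inv_mul_cancel] at h
    simp only [Set.mem_ofPred_eq, scalar_inv, base_inv, inv_pow, mul_pow, h, h1] at hu ⊢
    rw [mul_assoc, inv_mul_cancel_right, mul_left_comm, hu, mul_one, inv_mul_cancel]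

variable (ha) {n : ℕ} {ν : Q → ℂˣ} (hν : ∀ x y, a x y ^ n = ν x * ν y * (ν (x * y))⁻¹)

/-- The projection of `rootSubgroup ha hν` onto `Q`. -/
def rootProj : rootSubgroup ha hν →* Q := (proj ha).comp (Subgroup.subtype _)

lemma rootProj_surjective (hn : n ≠ 0) : Function.Surjective (rootProj ha hν) := by
  intro x
  obtain ⟨c, hc⟩ := IsAlgClosed.exists_pow_nat_eq ((ν x)⁻¹ : ℂ) (Nat.pos_of_ne_zero hn)
  have hc0 : c ≠ 0 := by
    rintro rfl
    rw [zero_pow hn] at hc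
    exact inv_ne_zero (ν x).ne_zero hc.symm
  refine ⟨⟨⟨x, Units.mk0 c hc0⟩, Units.ext ?_⟩, rfl⟩
  simp [hc]

lemma mem_ker_rootProj {u : rootSubgroup ha hν} :
    u ∈ (rootProj ha hν).ker ↔ u.1.base = 1 := Iff.rfl

lemma ker_rootProj_le_center :
    (rootProj ha hν).ker ≤ Subgroup.center (rootSubgroup ha hν) := by
  intro u hu
  rw [mem_ker_rootProj] at hu
  refine Subgroup.mem_center_iff.mpr fun v => Subtype.ext (CocycleExtension.ext ?_ ?_)
  · simp [hu]
  · simp [hu, ha.one_left, ha.one_right, mul_comm]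

/-- The kernel of `rootProj ha hν` consists of the `n`-th roots of unity. -/
def kerRootProjEquiv (h1 : a 1 1 = 1) : (rootProj ha hν).ker ≃* rootsOfUnity n ℂ where
  toFun u := ⟨u.1.1.scalar, by
    have h := hν 1 1
    rw [mul_one, mul_inv_cancel_right, h1, one_pow] at h
    have hu : u.1.1.scalar ^ n * ν u.1.1.base = 1 := u.1.2
    rw [(mem_ker_rootProj ha hν).mp u.2, ← h, mul_one] at hu
    exact (mem_rootsOfUnity n _).mpr hu⟩
  invFun c := ⟨⟨⟨1, c⟩, by
    have h := hν 1 1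
    rw [mul_one, mul_inv_cancel_right, h1, one_pow] at h
    change (c : ℂˣ) ^ n * ν 1 = 1
    rw [← h, mul_one]
    exact c.2⟩, rfl⟩
  left_inv u := Subtype.ext (Subtype.ext (CocycleExtension.ext
    ((mem_ker_rootProj ha hν).mp u.2).symm rfl))
  right_inv _ := rfl
  map_mul' u v := Subtype.ext <| by
    have h : a u.1.1.base v.1.1.base = 1 := by
      rw [(mem_ker_rootProj ha hν).mp u.2, ha.one_left, h1]
    exact (congrArg _ h).trans (mul_one _)

lemma finite_rootSubgroup [Finite Q] (h1 : a 1 1 = 1) (hn : n ≠ 0) :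
    Finite (rootSubgroup ha hν) := by
  have : NeZero n := ⟨hn⟩
  have := Finite.of_equiv _ (kerRootProjEquiv ha hν h1).symm.toEquiv
  have := Finite.of_equiv _
    (QuotientGroup.quotientKerEquivOfSurjective _ (rootProj_surjective ha hν hn)).symm.toEquiv
  exact Finite.of_equiv _
    (Subgroup.groupEquivQuotientProdSubgroup (s := (rootProj ha hν).ker)).symm

end CocycleExtension

end CocycleExtension

lemma IsIrrChar.of_monoidHom {Γ : Type} [Group Γ] [Finite Γ] (l : Γ →* ℂˣ) :
    IsIrrChar Γ fun g => (l g : ℂ) := by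
  have := Fintype.ofFinite Γ
  refine ⟨IsChar.of_monoidHom l, ?_⟩
  have h : ∀ g, ‖(l g : ℂ)‖ = 1 := fun g =>
    Complex.norm_eq_one_of_pow_eq_one (n := Nat.card Γ)
      (by rw [← Units.val_pow_eq_pow_val, ← map_pow, pow_card_eq_one', map_one, Units.val_one])
      Nat.card_pos.ne'
  rw [charInner_self_eq_ofReal]
  simp [h]

lemma ProjRepOfTriple.a_one_one {G : Type} [Group G] {N : Subgroup G} [N.Normal] {θ : N → ℂ}
    (hθ : IsIrrChar N θ) (P : ProjRepOfTriple G N θ) : P.a 1 1 = 1 := by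
  have hone := P.traceN 1
  have h := congrArg Matrix.trace (P.factor 1 1)
  rw [Subgroup.coe_one] at hone
  rw [QuotientGroup.mk_one, mul_one, P.map_one, Matrix.trace_smul, mul_one, ← P.map_one, hone,
    smul_eq_mul, eq_comm, mul_eq_right₀ hθ.apply_one_ne_zero] at h
  exact Units.ext h

theorem triple_isomorphic_to_central_cyclic_triple
    {G : Type} [Group G] [Finite G] (N : Subgroup G) [N.Normal]
    (θ : ↥N → ℂ) (hθ : IsIrrChar ↥N θ) (hinv : IsGInvariant N θ)
    (P : ProjRepOfTriple G N θ) :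
    Nonempty (CentralTripleRealization G N θ (cocycleClassOrder P.a)) := by
  obtain ⟨hn, ν, hν⟩ := P.cocycle.cocycleClassOrder_spec
  have h1 := P.a_one_one hθ
  have : NeZero (cocycleClassOrder P.a) := ⟨hn.ne'⟩
  have := CocycleExtension.finite_rootSubgroup P.cocycle hν h1 hn.ne'
  let π := CocycleExtension.rootProj P.cocycle hν
  let e := CocycleExtension.kerRootProjEquiv P.cocycle hν h1
  let l : π.ker →* ℂˣ := (Subgroup.subtype _).comp e.toMonoidHom
  have hl : Function.Injective l := Subtype.val_injective.comp e.injective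
  have hcentral : π.ker ≤ Subgroup.center _ := CocycleExtension.ker_rootProj_le_center P.cocycle hν
  have hnorm : ∀ z, ‖(l z : ℂ)‖ = 1 := fun z =>
    Complex.norm_eq_one_of_mem_rootsOfUnity (e z).2
  exact ⟨{
    G' := CocycleExtension.rootSubgroup P.cocycle hν
    N' := π.ker
    θ' := fun z => ((l⁻¹ z : ℂˣ) : ℂ)
    central := hcentral
    cyc := isCyclic_of_injective e.toMonoidHom e.injective
    card_eq := by
      rw [Nat.card_congr e.toEquiv, Complex.card_rootsOfUnity]
    lin := ⟨l⁻¹, fun _ => rfl, inv_injective.comp hl⟩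
    inv' := fun g z => by
      have h : g * (z : _) * g⁻¹ = z := by
        rw [Subgroup.mem_center_iff.mp (hcentral z.2) g, mul_inv_cancel_right]
      simp only [h]
    irr' := IsIrrChar.of_monoidHom l⁻¹
    iso := P.charTripleIso (s := fun u => u.1.scalar)
      (CocycleExtension.rootProj_surjective P.cocycle hν hn.ne') hθ
      (by simp [h1]) (fun _ _ => rfl) fun z => by
        change _ = (l z : ℂ)
        rw [MonoidHom.inv_apply, Units.val_inv_eq_inv_val, Complex.inv_eq_conj (hnorm z),
          Complex.conj_conj] }⟩
end
end
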